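/- Let V be a reproducing kernel Hilbert space of vector fields with kernel R(x,y)I_{d×d}, continuously embedded in C_0^3(Ω,ℝ^d), Ω a bounded open subset of ℝ^d, and let e^{H(·)} be a C¹(Ω̄,ℝ) density on Ω. For v ∈ V^{[0,1]} define the diagnostic field D_t^v(x) = (1/n) Σ_{k=1}^n (β_{k,t}^v)ᵀ R(x, X_{k,t}^v) + (1/n) Σ_{k=1}^n ∇_y R(x,y)|_{y=X_{k,t}^v}, with X_{k,t}^v = φ^v_t(X_k) and β_{k,t}^v = ∇H(X^v_{k,1}) Dφ^v_{t1}(X^v_{k,t}) + ∇ log det Dφ^v_{t1}(X^v_{k,t}). Then the maximal directional derivative of the penalized log-likelihood satisfies ( ∫₀¹ ‖λ v_t − D_t^v‖²_V dt )^{1/2} = sup over u ∈ V^{[0,1]} with ‖u‖_{V^{[0,1]}} = 1 of [ d/dε E_λ(v + εu) ]_{ε=0}. -/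

import Mathlib

open MeasureTheory Set Filter
open scoped RealInnerProductSpace BigOperators Topology

noncomputable section

abbrev Euc (d : ℕ) := EuclideanSpace ℝ (Fin d)

/-- The `C^k` sup-norm `‖f‖_{k,∞} = Σ_{j≤k} sup_{|β|=j} sup_Ω |D^β f|` over `Ω`,
expressed via iterated Fréchet derivatives. -/
def CknormOn {d : ℕ} (k : ℕ) (Ω : Set (Euc d)) (f : Euc d → Euc d) : ℝ :=
  ∑ j ∈ Finset.range (k + 1), ⨆ x ∈ Ω, ‖iteratedFDeriv ℝ j f x‖

/-- Membership in `C_0^k(Ω, ℝ^d)`: `C^k` on `Ω`, with all derivatives of order `≤ k`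
extending continuously by `0` to the boundary of `Ω`. -/
def MemC0k {d : ℕ} (k : ℕ) (Ω : Set (Euc d)) (f : Euc d → Euc d) : Prop :=
  ContDiffOn ℝ k f Ω ∧
    ∀ j ≤ k, ∀ x ∈ frontier Ω,
      Tendsto (iteratedFDeriv ℝ j f) (𝓝[Ω] x) (𝓝 0)

/-- `v ∈ V^{[0,1]}`: a measurable map `[0,1] → V` with `∫₀¹ ‖v_t‖² dt < ∞`. -/
def InV01 {V : Type*} [NormedAddCommGroup V] [MeasurableSpace V] (v : ℝ → V) : Prop :=
  Measurable v ∧ IntegrableOn (fun t => ‖v t‖ ^ 2) (Icc (0:ℝ) 1)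

/-- The norm `‖v‖_{V^{[0,1]}} = (∫₀¹ ‖v_t‖² dt)^{1/2}`. -/
def normV01 {V : Type*} [NormedAddCommGroup V] (v : ℝ → V) : ℝ :=
  Real.sqrt (∫ t in (0:ℝ)..1, ‖v t‖ ^ 2)

/-- Divergence of a vector field: the trace of its Jacobian. -/
def divg {d : ℕ} (f : Euc d → Euc d) (x : Euc d) : ℝ :=
  LinearMap.trace ℝ (Euc d) (fderiv ℝ f x : Euc d →ₗ[ℝ] Euc d)

/-- The penalized log-likelihood
`E_λ(v) = (1/n) Σ_k [log det Dφ^v_1(X_k) + H(φ^v_1(X_k))] − (λ/2)∫₀¹‖v_t‖²dt`,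
where `Φ v s t` is the flow of `v` from time `s` to time `t` (so `φ^v_1 = Φ v 0 1`). -/
def Elam {d : ℕ} {V : Type*} [NormedAddCommGroup V] [InnerProductSpace ℝ V]
    (ι : V →ₗ[ℝ] (Euc d → Euc d)) (Φ : (ℝ → V) → ℝ → ℝ → Euc d → Euc d)
    (H : Euc d → ℝ) {n : ℕ} (X : Fin n → Euc d) (lam : ℝ) (v : ℝ → V) : ℝ :=
  (1 / (n : ℝ)) *
      ∑ k, (Real.log ((fderiv ℝ (Φ v 0 1) (X k)).det) + H (Φ v 0 1 (X k)))
    - (lam / 2) * ∫ t in (0:ℝ)..1, ‖v t‖ ^ 2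

section

/-- lexicographic minimum of a closed nonempty set -/
theorem lexmin_exists (C : Set (ℕ → ℕ)) (hC : IsClosed C) (hne : C.Nonempty) :
    ∃ x ∈ C, ∀ y ∈ C, ∀ n, (∀ i < n, y i = x i) → x n ≤ y n := by
  let D : ℕ → Set (ℕ → ℕ) := fun n => Nat.rec C
    (fun n S => {y ∈ S | y n = sInf ((fun y : ℕ → ℕ => y n) '' S)}) n
  have hD0 : D 0 = C := rfl
  have hDs : ∀ n, D (n+1) = {y ∈ D n | y n = sInf ((fun y : ℕ → ℕ => y n) '' D n)} := fun n => rfl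
  let x : ℕ → ℕ := fun n => sInf ((fun y : ℕ → ℕ => y n) '' D n)
  have hne' : ∀ n, (D n).Nonempty := by
    intro n
    induction n with
    | zero => exact hne
    | succ n ih =>
      obtain ⟨y, hy, hyn⟩ := Nat.sInf_mem (ih.image (fun y : ℕ → ℕ => y n))
      exact ⟨y, by rw [hDs]; exact ⟨hy, hyn⟩⟩
  have hmem : ∀ n y, y ∈ D n ↔ y ∈ C ∧ ∀ i < n, y i = x i := by
    intro n
    induction n with
    | zero => intro y; simp [hD0]
    | succ n ih =>
      intro y
      rw [hDs]
      constructor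
      · rintro ⟨h1, h2⟩
        refine ⟨((ih y).1 h1).1, fun i hi => ?_⟩
        rcases Nat.lt_succ_iff_lt_or_eq.1 hi with h | h
        · exact ((ih y).1 h1).2 i h
        · subst h; exact h2
      · rintro ⟨h1, h2⟩
        exact ⟨(ih y).2 ⟨h1, fun i hi => h2 i (by omega)⟩, h2 n (by omega)⟩
  choose y hy using hne'
  refine ⟨x, ?_, ?_⟩
  · have : Tendsto y atTop (𝓝 x) := by
      rw [tendsto_pi_nhds]
      intro i
      apply tendsto_const_nhds.congr'
      filter_upwards [eventually_gt_atTop i] with n hn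
      exact (((hmem n _).1 (hy n)).2 i hn).symm
    exact hC.mem_of_tendsto this (Eventually.of_forall fun n => ((hmem n _).1 (hy n)).1)
  · intro z hz n hn
    exact Nat.sInf_le ⟨z, (hmem n z).2 ⟨hz, hn⟩, rfl⟩

theorem simpson_aux {D : Type*} (h : (ℕ → ℕ) → D) (hs : Function.Surjective h)
    (hcl : ∀ d, IsClosed (h ⁻¹' {d})) (hm : ∀ B : Set D, MeasurableSet (h ⁻¹' B)) :
    Countable D := by
  let Z : Set (ℕ → ℕ) := {x | ∀ y, h y = h x → ∀ n, (∀ i < n, y i = x i) → x n ≤ y n}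
  have hinj : InjOn h Z := by
    intro x hx y hy hxy
    by_contra hne
    have hex : ∃ n, x n ≠ y n := by
      by_contra hcon
      push Not at hcon
      exact hne (funext hcon)
    classical
    have hlt : ∀ i < Nat.find hex, x i = y i := fun i hi => by
      have := Nat.find_min hex hi
      push Not at this
      exact this
    have h1 := hx y hxy.symm (Nat.find hex) (fun i hi => (hlt i hi).symm)
    have h2 := hy x hxy (Nat.find hex) hlt
    exact Nat.find_spec hex (le_antisymm h1 h2)
  have hsurj : ∀ d, ∃ x ∈ Z, h x = d := by
    intro d
    obtain ⟨x, hx, hx'⟩ := lexmin_exists _ (hcl d) (by obtain ⟨x, hx⟩ := hs d; exact ⟨x, hx⟩)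
    refine ⟨x, fun y hy n hn => hx' y ?_ n hn, hx⟩
    exact hy.trans hx
  have hZc : Zᶜ = ⋃ n : ℕ, ⋃ k : ℕ, ⋃ s : Fin n → ℕ,
      ({x | ∀ i : Fin n, x i = s i} ∩ {x | k < x n} ∩
        h ⁻¹' (h '' {y | (∀ i : Fin n, y i = s i) ∧ y n = k})) := by
    ext x
    simp only [Z, mem_compl_iff, mem_ofPred_eq, mem_iUnion, mem_inter_iff, mem_preimage, mem_image]
    push Not
    constructor
    · rintro ⟨y, hy, n, hn, hlt⟩
      exact ⟨n, y n, fun i => x i, ⟨fun i => rfl, hlt⟩, y, ⟨fun i => hn i i.2, rfl⟩, hy⟩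
    · rintro ⟨n, k, s, ⟨h1, h2⟩, y, ⟨h3, h4⟩, h5⟩
      refine ⟨y, h5, n, fun i hi => ?_, by omega⟩
      rw [h3 ⟨i, hi⟩, h1 ⟨i, hi⟩]
  have hZ : MeasurableSet Z := by
    rw [← MeasurableSet.compl_iff, hZc]
    refine MeasurableSet.iUnion fun n => MeasurableSet.iUnion fun k => MeasurableSet.iUnion fun s =>
      (MeasurableSet.inter ?_ ?_).inter (hm _)
    · rw [show {x : ℕ → ℕ | ∀ i : Fin n, x i = s i} = ⋂ i : Fin n, {x | x i = s i} by
        ext; simp]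
      exact MeasurableSet.iInter fun i =>
        measurableSet_eq_fun (measurable_pi_apply _) measurable_const
    · exact measurableSet_lt measurable_const (measurable_pi_apply _)
  have hsub : ∀ S ⊆ Z, MeasurableSet S := by
    intro S hS
    have : S = Z ∩ h ⁻¹' (h '' S) := by
      ext x
      constructor
      · intro hx; exact ⟨hS hx, x, hx, rfl⟩
      · rintro ⟨hx, y, hy, hyx⟩
        rwa [← hinj (hS hy) hx hyx]
    rw [this]
    exact hZ.inter (hm _)
  by_contra hD
  have hZu : ¬ Countable Z := by
    intro hc
    apply hD
    have : Function.Surjective (fun x : Z => h x) := by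
      intro d
      obtain ⟨x, hx, hxd⟩ := hsurj d
      exact ⟨⟨x, hx⟩, hxd⟩
    exact this.countable
  have : StandardBorelSpace Z := hZ.standardBorel
  let e : Z ≃ᵐ ℝ := PolishSpace.measurableEquivOfNotCountable hZu
    (by rw [Set.countable_univ_iff.symm]; exact Cardinal.not_countable_real)
  have hall : ∀ S : Set ℝ, MeasurableSet S := by
    intro S
    have h1 : MeasurableSet (e ⁻¹' S) := by
      have := hsub (Subtype.val '' (e ⁻¹' S)) (by rintro _ ⟨x, -, rfl⟩; exact x.2)
      have h2 := measurable_subtype_coe (p := (· ∈ Z)) this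
      rwa [preimage_image_eq _ Subtype.val_injective] at h2
    exact (e.measurableSet_preimage).1 h1
  have hcard : Cardinal.mk {s : Set ℝ // MeasurableSet s} ≤ Cardinal.continuum := by
    obtain ⟨b, hb, -, hb2⟩ := TopologicalSpace.exists_countable_basis ℝ
    have := MeasurableSpace.cardinal_measurableSet_le_continuum (s := b)
      ((Cardinal.mk_le_aleph0_iff.2 hb.to_subtype).trans Cardinal.aleph0_le_continuum)
    rwa [← hb2.borel_eq_generateFrom, ← BorelSpace.measurable_eq] at this
  have h3 : Cardinal.mk (Set ℝ) ≤ Cardinal.mk {s : Set ℝ // MeasurableSet s} :=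
    Cardinal.mk_le_of_injective (f := fun S => ⟨S, hall S⟩) (fun a b hab => by simpa using hab)
  have h4 := h3.trans hcard
  rw [Cardinal.mk_set, Cardinal.mk_real] at h4
  exact absurd (Cardinal.cantor Cardinal.continuum) (not_lt.2 h4)

theorem cont_meas_borel {β : Type*} [TopologicalSpace β] (k : (ℕ → ℕ) → β) (hk : Continuous k) :
    @Measurable (ℕ → ℕ) β _ (borel β) k := by
  borelize β
  exact hk.measurable

theorem closed_fib {β : Type*} [TopologicalSpace β] (k : (ℕ → ℕ) → β) (h : β → ℝ)
    (hk : Continuous k) (hh : Continuous h) (d : ℝ) : IsClosed ((h ∘ k) ⁻¹' {d}) :=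
  isClosed_singleton.preimage (hh.comp hk)

theorem simpson_surj {D : Type*} (f : ℝ → D) (hs : Function.Surjective f)
    (hm : ∀ B : Set D, MeasurableSet (f ⁻¹' B)) : Countable D := by
  obtain ⟨g, hg⟩ := hs.hasRightInverse
  have hgi : Function.Injective g := hg.injective
  have hmeas : Measurable (g ∘ f) := fun S _ => by
    rw [preimage_comp]; exact hm _
  obtain ⟨t', ht', hcont, hpol⟩ := hmeas.exists_continuous
  obtain ⟨k, hk, hks⟩ := @PolishSpace.exists_nat_nat_continuous_surjective ℝ t' hpol ⟨(0:ℝ)⟩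
  have hkm : @Measurable _ ℝ _ Real.measurableSpace k := by
    have h1 : @Measurable (ℕ → ℕ) ℝ _ (@borel ℝ t') k := by
      exact cont_meas_borel k hk
    have h2 : Real.measurableSpace ≤ @borel ℝ t' := borel_anti ht'
    exact h1.mono le_rfl h2
  refine simpson_aux (f ∘ k) (hs.comp hks) (fun d => ?_) (fun B => ?_)
  · have : f ∘ k ⁻¹' {d} = (g ∘ f ∘ k) ⁻¹' {g d} := by
      ext x; simp [hgi.eq_iff]
    rw [this]
    exact @closed_fib ℝ t' k (g ∘ f) hk hcont (g d)
  · rw [preimage_comp]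
    exact hkm (hm B)

theorem simpson {V : Type*} [MetricSpace V] [MeasurableSpace V] [BorelSpace V]
    (f : ℝ → V) (hf : Measurable f) : TopologicalSpace.IsSeparable (range f) := by
  have key : ∀ ε : ℝ, 0 < ε → ∃ D : Set V, D.Countable ∧ ∀ x ∈ range f, ∃ y ∈ D, dist x y < ε := by
    intro ε hε
    obtain ⟨D, hD⟩ := zorn_subset {D : Set V | D ⊆ range f ∧ D.Pairwise fun x y => ε ≤ dist x y} (by
      intro c hc hchain
      refine ⟨⋃₀ c, ⟨sUnion_subset fun s hs => (hc hs).1, ?_⟩, fun s hs => subset_sUnion_of_mem hs⟩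
      exact (pairwise_sUnion hchain.directedOn).2 fun s hs => (hc hs).2)
    have hDsub := hD.prop.1
    have hDp := hD.prop.2
    refine ⟨D, ?_, ?_⟩
    · have hclosed : ∀ B ⊆ D, IsClosed B := by
        intro B hB
        apply Metric.isClosed_of_pairwise_le_dist hε
        exact hDp.mono hB
      rcases D.eq_empty_or_nonempty with h0 | ⟨d0, hd0⟩
      · rw [h0]; exact countable_empty
      classical
      let f' : ℝ → D := fun x => if h : f x ∈ D then ⟨f x, h⟩ else ⟨d0, hd0⟩
      have : Countable D := by
        apply simpson_surj f'
        · rintro ⟨d, hd⟩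
          obtain ⟨x, rfl⟩ := hDsub hd
          exact ⟨x, by simp [f', hd]⟩
        · intro B
          have hB1 : MeasurableSet (f ⁻¹' (Subtype.val '' B)) :=
            hf (hclosed _ (by rintro _ ⟨x, -, rfl⟩; exact x.2)).measurableSet
          have hB2 : MeasurableSet (f ⁻¹' D) := hf (hclosed _ subset_rfl).measurableSet
          have : f' ⁻¹' B = f ⁻¹' (Subtype.val '' B) ∪
              ((f ⁻¹' D)ᶜ ∩ {x | (⟨d0, hd0⟩ : D) ∈ B}) := by
            ext x
            by_cases h : f x ∈ D <;> simp [f', h]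
          rw [this]
          exact hB1.union (hB2.compl.inter (MeasurableSet.const _))
      exact this.to_set
    · intro x hx
      by_contra hcon
      push Not at hcon
      have : insert x D ⊆ D := by
        apply hD.le_of_ge ⟨insert_subset hx hDsub, ?_⟩ (subset_insert _ _)
        rw [pairwise_insert]
        refine ⟨hDp, fun y hy _ => ⟨hcon y hy, by rw [dist_comm]; exact hcon y hy⟩⟩
      have hxD : x ∈ D := this (mem_insert _ _)
      have := hcon x hxD
      simp at this
      linarith
  choose! D hDc hD using key
  refine ⟨⋃ n : ℕ, D (1 / ((n:ℝ) + 1)), countable_iUnion fun n => hDc _ (by positivity), ?_⟩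
  intro x hx
  rw [Metric.mem_closure_iff]
  intro ε hε
  obtain ⟨n, hn⟩ := exists_nat_one_div_lt hε
  obtain ⟨y, hy, hxy⟩ := hD (1 / ((n:ℝ) + 1)) (by positivity) x hx
  exact ⟨y, mem_iUnion.2 ⟨n, hy⟩, hxy.trans hn⟩

theorem stronglyMeasurable_of_real {V : Type*} [MetricSpace V] [MeasurableSpace V] [BorelSpace V]
    (f : ℝ → V) (hf : Measurable f) : StronglyMeasurable f :=
  stronglyMeasurable_iff_measurable_separable.2 ⟨hf, simpson f hf⟩
end

section

theorem ac_of_dist_le {F G : Type*} [PseudoMetricSpace F] [PseudoMetricSpace G] {f : ℝ → F} {g : ℝ → G} {a b : ℝ} (K : ℝ)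
    (hg : AbsolutelyContinuousOnInterval g a b)
    (h : ∀ x ∈ uIcc a b, ∀ y ∈ uIcc a b, dist (f x) (f y) ≤ K * dist (g x) (g y)) :
    AbsolutelyContinuousOnInterval f a b := by
  unfold AbsolutelyContinuousOnInterval at hg ⊢
  apply squeeze_zero' ?_ ?_ (by simpa using (hg.const_mul K))
  · exact Filter.Eventually.of_forall <| fun _ ↦ Finset.sum_nonneg (fun i hi ↦ dist_nonneg)
  rw [eventually_inf_principal]
  filter_upwards with (n, I) hnI
  simp only [Finset.mul_sum]
  gcongr with i hi
  simp only [AbsolutelyContinuousOnInterval.disjWithin, mem_ofPred_eq] at hnI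
  exact h _ (hnI.1 i hi).1 _ (hnI.1 i hi).2

section
variable {F : Type*} [NormedAddCommGroup F] [NormedSpace ℝ F]

def IsPrim (y y' : ℝ → F) (a b : ℝ) : Prop :=
  IntervalIntegrable y' volume a b ∧ ∀ t ∈ Icc a b, y t = y a + ∫ s in a..t, y' s

variable {G : Type*} [NormedAddCommGroup G] [NormedSpace ℝ G]

theorem IsPrim.ii {y y' : ℝ → F} {a b s t : ℝ} (h : IsPrim y y' a b) 
    (hs : s ∈ Icc a b) (ht : t ∈ Icc a b) : IntervalIntegrable y' volume s t := by
  have hab : a ≤ b := hs.1.trans hs.2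
  apply h.1.mono_set
  rw [uIcc_of_le hab]
  exact ordConnected_Icc.uIcc_subset hs ht

theorem IsPrim.sub {y y' : ℝ → F} {a b s t : ℝ} (h : IsPrim y y' a b) 
    (hs : s ∈ Icc a b) (ht : t ∈ Icc a b) : y t = y s + ∫ r in s..t, y' r := by
  have ha : a ∈ Icc a b := ⟨le_rfl, hs.1.trans hs.2⟩
  rw [h.2 t ht, h.2 s hs, add_assoc, intervalIntegral.integral_add_adjacent_intervals (h.ii ha hs) (h.ii hs ht)]

theorem IsPrim.mono {y y' : ℝ → F} {a b s t : ℝ} (h : IsPrim y y' a b) 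
    (hs : s ∈ Icc a b) (ht : t ∈ Icc a b) : IsPrim y y' s t :=
  ⟨h.ii hs ht, fun _ hr => h.sub hs ⟨hs.1.trans hr.1, hr.2.trans ht.2⟩⟩

theorem IsPrim.ac {y y' : ℝ → F} {a b : ℝ} (h : IsPrim y y' a b) (hab : a ≤ b) :
    AbsolutelyContinuousOnInterval y a b := by
  have h1 := h.1.norm.absolutelyContinuousOnInterval_intervalIntegral (c := a) (by simp)
  apply ac_of_dist_le 1 h1
  rw [uIcc_of_le hab]
  intro s hs t ht
  have ha : a ∈ Icc a b := ⟨le_rfl, hs.1.trans hs.2⟩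
  rw [one_mul, dist_comm, dist_comm (∫ _ in _.._, _), dist_eq_norm, dist_eq_norm, h.sub hs ht, add_sub_cancel_left,
    intervalIntegral.integral_interval_sub_left (h.ii ha ht).norm (h.ii ha hs).norm]
  exact intervalIntegral.norm_integral_le_abs_integral_norm

theorem IsPrim.cont {y y' : ℝ → F} {a b : ℝ} (h : IsPrim y y' a b) (hab : a ≤ b) :
    ContinuousOn y (Icc a b) := by
  have := (h.ac hab).continuousOn
  rwa [uIcc_of_le hab] at this

theorem IsPrim.ae [CompleteSpace F] {y y' : ℝ → F} {a b : ℝ} (h : IsPrim y y' a b) (hab : a ≤ b) :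
    ∀ᵐ x, x ∈ Ioo a b → HasDerivAt y (y' x) x := by
  filter_upwards [h.1.ae_hasDerivAt_integral] with x hx hxm
  have h1 := hx (by rw [uIcc_of_le hab]; exact Ioo_subset_Icc_self hxm) a (by simp)
  have h2 := h1.const_add (y a)
  apply h2.congr_of_eventuallyEq
  filter_upwards [Ioo_mem_nhds hxm.1 hxm.2] with t ht
  exact h.2 t (Ioo_subset_Icc_self ht)

theorem aesm_apply {α : Type*} [MeasurableSpace α] {μ : Measure α} {A : α → F →L[ℝ] G} {f : α → F}
    (hA : AEStronglyMeasurable A μ) (hf : AEStronglyMeasurable f μ) :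
    AEStronglyMeasurable (fun x => A x (f x)) μ :=
  (isBoundedBilinearMap_apply (𝕜 := ℝ) (E := F) (F := G)).continuous.comp_aestronglyMeasurable
    (hA.prodMk hf)

theorem ae_ne (a : ℝ) : ∀ᵐ x : ℝ, x ≠ a := by
  simp [ae_iff]

/-- converse -/
theorem isPrim_of_ac [CompleteSpace F] {y y' : ℝ → F} {a b : ℝ} (hab : a ≤ b)
    (hi : IntervalIntegrable y' volume a b)
    (hy : AbsolutelyContinuousOnInterval y a b) (hd : ∀ᵐ x, x ∈ Ioo a b → HasDerivAt y (y' x) x) :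
    IsPrim y y' a b := by
  refine ⟨hi, ?_⟩
  let w : ℝ → F := fun t => ∫ s in a..t, y' s
  have hw : IsPrim w y' a b := ⟨hi, fun t ht => by simp [w]⟩
  have h1 := hy.sub (hw.ac hab)
  -- work on each [a', b'] inside
  have hder : ∀ᵐ x, x ∈ uIcc a b → HasDerivAt (y - w) 0 x := by
    filter_upwards [hd, hw.ae hab, ae_ne a, ae_ne b] with x h1 h2 h3 h4 hx
    rw [uIcc_of_le hab] at hx
    have hx' : x ∈ Ioo a b := ⟨lt_of_le_of_ne hx.1 h3.symm, lt_of_le_of_ne hx.2 h4⟩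
    simpa using (h1 hx').sub (h2 hx')
  obtain ⟨C, hC⟩ := h1.const_of_ae_hasDerivAt_zero hder
  rw [uIcc_of_le hab] at hC
  intro t ht
  have e1 := hC t ht
  have e2 := hC a ⟨le_rfl, hab⟩
  simp only [Pi.sub_apply, w, intervalIntegral.integral_same, sub_zero] at e1 e2
  rw [e2, ← e1]; abel

theorem IsPrim.comp [FiniteDimensional ℝ F] [CompleteSpace G] {y y' : ℝ → F} {a b : ℝ} (h : IsPrim y y' a b)
    (hab : a ≤ b) {g : F → G} (hg : ContDiff ℝ 1 g) :
    IsPrim (fun t => g (y t)) (fun t => fderiv ℝ g (y t) (y' t)) a b := by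
  have : CompleteSpace F := FiniteDimensional.complete ℝ F
  have : ProperSpace F := FiniteDimensional.proper ℝ F
  have hyc := h.cont hab
  apply isPrim_of_ac hab
  · have hc : ContinuousOn (fun t => fderiv ℝ g (y t)) (uIcc a b) := by
      rw [uIcc_of_le hab]
      exact (hg.continuous_fderiv one_ne_zero).comp_continuousOn hyc
    obtain ⟨C, hC⟩ := isCompact_uIcc.exists_bound_of_continuousOn hc
    rw [intervalIntegrable_iff_integrableOn_Ioc_of_le hab]
    have h1 := h.1
    rw [intervalIntegrable_iff_integrableOn_Ioc_of_le hab] at h1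
    rw [uIcc_of_le hab] at hc hC
    apply Integrable.mono' (h1.norm.const_mul C)
    · exact aesm_apply ((hc.mono Ioc_subset_Icc_self).aestronglyMeasurable measurableSet_Ioc) h1.1
    · filter_upwards [ae_restrict_mem measurableSet_Ioc] with t ht
      exact (ContinuousLinearMap.le_opNorm _ _).trans (by gcongr; exact hC t (Ioc_subset_Icc_self ht))
  · obtain ⟨R, hR⟩ := (isCompact_Icc (a := a) (b := b)).exists_bound_of_continuousOn hyc
    obtain ⟨K, hK⟩ := (hg.contDiffOn (s := Metric.closedBall 0 R)).exists_lipschitzOnWith one_ne_zero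
      (convex_closedBall _ _) (isCompact_closedBall _ _)
    apply ac_of_dist_le K (h.ac hab)
    rw [uIcc_of_le hab]
    intro s hs t ht
    exact hK.dist_le_mul _ (by simpa using hR s hs) _ (by simpa using hR t ht)
  · filter_upwards [h.ae hab] with x hx hxm
    have := ((hg.differentiable one_ne_zero) (y x)).hasFDerivAt.comp_hasDerivAt x (hx hxm)
    exact this

theorem IsPrim.prod {y y' : ℝ → F} {z z' : ℝ → G} {a b : ℝ} (h : IsPrim y y' a b)
    [CompleteSpace F] [CompleteSpace G]
    (hz : IsPrim z z' a b) : IsPrim (fun t => (y t, z t)) (fun t => (y' t, z' t)) a b := by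
  have hi : IntervalIntegrable (fun t => (y' t, z' t)) volume a b := ⟨h.1.1.prodMk hz.1.1, h.1.2.prodMk hz.1.2⟩
  refine ⟨hi, fun t ht => ?_⟩
  have hi' : IntervalIntegrable (fun t => (y' t, z' t)) volume a t := by
    have ha : a ∈ Icc a b := ⟨le_rfl, ht.1.trans ht.2⟩
    exact ⟨(h.ii ha ht).1.prodMk (hz.ii ha ht).1, (h.ii ha ht).2.prodMk (hz.ii ha ht).2⟩
  have h1 := (ContinuousLinearMap.fst ℝ F G).intervalIntegral_comp_comm hi'
  have h2 := (ContinuousLinearMap.snd ℝ F G).intervalIntegral_comp_comm hi'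
  simp at h1 h2
  ext
  · simp [h.2 t ht, h1]
  · simp [hz.2 t ht, h2]

theorem IsPrim.clm [CompleteSpace F] [CompleteSpace G] {y y' : ℝ → F} {a b : ℝ} (h : IsPrim y y' a b)
    (L : F →L[ℝ] G) : IsPrim (fun t => L (y t)) (fun t => L (y' t)) a b := by
  refine ⟨⟨L.integrable_comp h.1.1, L.integrable_comp h.1.2⟩, fun t ht => ?_⟩
  have ha : a ∈ Icc a b := ⟨le_rfl, ht.1.trans ht.2⟩
  simp only [L.intervalIntegral_comp_comm (h.ii ha ht), h.2 t ht, map_add]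

theorem IsPrim.bilin [FiniteDimensional ℝ F] [FiniteDimensional ℝ G] {H : Type*} [NormedAddCommGroup H] [NormedSpace ℝ H] [CompleteSpace H]
    {y y' : ℝ → F} {z z' : ℝ → G} {a b : ℝ} (h : IsPrim y y' a b)
    (hz : IsPrim z z' a b) (hab : a ≤ b) (B : F →L[ℝ] G →L[ℝ] H) :
    IsPrim (fun t => B (y t) (z t)) (fun t => B (y t) (z' t) + B (y' t) (z t)) a b := by
  have : CompleteSpace F := FiniteDimensional.complete ℝ F
  have : CompleteSpace G := FiniteDimensional.complete ℝ G
  have h1 := (h.prod hz).comp hab (g := fun p : F × G => B p.1 p.2)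
    (B.isBoundedBilinearMap.contDiff)
  convert h1 using 2 with t
  have := (B.isBoundedBilinearMap.hasFDerivAt (y t, z t)).fderiv
  rw [this]
  simp

theorem IsPrim.congr' {y y' z' : ℝ → F} {a b : ℝ} (h : IsPrim y y' a b) (hab : a ≤ b)
    (he : ∀ t ∈ Icc a b, y' t = z' t) : IsPrim y z' a b := by
  refine ⟨h.1.congr ?_, fun t ht => ?_⟩
  · intro x hx
    rw [uIoc_of_le hab] at hx
    exact he x (Ioc_subset_Icc_self hx)
  · rw [h.2 t ht]
    congr 1
    apply intervalIntegral.integral_congr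
    intro x hx
    rw [uIcc_of_le ht.1] at hx
    exact he x ⟨hx.1, hx.2.trans ht.2⟩

theorem IsPrim.congr_left {y z y' : ℝ → F} {a b : ℝ} (h : IsPrim y y' a b) (hab : a ≤ b)
    (he : ∀ t ∈ Icc a b, y t = z t) : IsPrim z y' a b :=
  ⟨h.1, fun t ht => by rw [← he t ht, ← he a ⟨le_rfl, hab⟩, h.2 t ht]⟩

theorem gronwall_int {φ m : ℝ → ℝ} {a b C : ℝ} (hφ : ContinuousOn φ (Icc a b)) 
    (hm : IntervalIntegrable m volume a b) (hm0 : ∀ t, 0 ≤ m t)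
    (h : ∀ t ∈ Icc a b, φ t ≤ C + ∫ s in a..t, m s * φ s) (t : ℝ) (ht : t ∈ Icc a b) :
    φ t ≤ C * Real.exp (∫ s in a..t, m s) := by
  have hab : a ≤ b := ht.1.trans ht.2
  let ψ : ℝ → ℝ := fun t => C + ∫ s in a..t, m s * φ s
  let μ : ℝ → ℝ := fun t => ∫ s in a..t, m s
  have hmφ : IntervalIntegrable (fun s => m s * φ s) volume a b :=
    hm.mul_continuousOn (by rwa [uIcc_of_le hab])
  have hψ : IsPrim ψ (fun s => m s * φ s) a b := ⟨hmφ, fun t ht => by simp [ψ]⟩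
  have hμ : IsPrim μ m a b := ⟨hm, fun t ht => by simp [μ]⟩
  have hp := (hμ.prod hψ).comp hab (g := fun p : ℝ × ℝ => Real.exp (-p.1) * p.2)
    (by fun_prop)
  have hd : ∀ p q : ℝ × ℝ, fderiv ℝ (fun p : ℝ × ℝ => Real.exp (-p.1) * p.2) p q
      = Real.exp (-p.1) * (q.2 - q.1 * p.2) := by
    intro p q
    have h1 : HasFDerivAt (fun p : ℝ × ℝ => Real.exp (-p.1))
      (Real.exp (-p.1) • -(ContinuousLinearMap.fst ℝ ℝ ℝ)) p := 
      ((hasFDerivAt_fst (p := p)).neg).exp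
    have := (h1.mul (hasFDerivAt_snd (p := p))).fderiv
    erw [this]
    simp; ring
  have h2 := hp.2 t ht
  have h3 : ∫ s in a..t, fderiv ℝ (fun p : ℝ × ℝ => Real.exp (-p.1) * p.2) (μ s, ψ s) (m s, m s * φ s) ≤ 0 := by
    rw [← neg_nonneg, ← intervalIntegral.integral_neg]
    apply intervalIntegral.integral_nonneg ht.1
    intro s hs
    rw [hd]
    have e1 := h s ⟨hs.1, hs.2.trans ht.2⟩
    have e2 : m s * φ s ≤ m s * ψ s := mul_le_mul_of_nonneg_left e1 (hm0 s)
    have e3 := Real.exp_pos (-μ s)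
    have : 0 ≤ Real.exp (-μ s) * (m s * ψ s - m s * φ s) := mul_nonneg e3.le (by linarith)
    simp only
    linarith
  have h4 : μ a = 0 := by simp [μ]
  have h5 : ψ a = C := by simp [ψ]
  simp only [h4, h5] at h2
  have h6 : Real.exp (-μ t) * ψ t ≤ C := by
    simp only [neg_zero, Real.exp_zero, one_mul] at h2
    linarith
  have h7 : φ t ≤ ψ t := h t ht
  rw [Real.exp_neg, inv_mul_le_iff₀ (Real.exp_pos _)] at h6
  calc φ t ≤ ψ t := h7
    _ ≤ _ := by rw [mul_comm]; exact h6
end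
end

section

section
variable {F : Type*} [NormedAddCommGroup F] [NormedSpace ℝ F]
variable {G : Type*} [NormedAddCommGroup G] [NormedSpace ℝ G]

theorem ii_apply {A : ℝ → F →L[ℝ] G} {c : ℝ → F} {a b : ℝ} (hab : a ≤ b)
    (hA : IntervalIntegrable A volume a b) (hc : ContinuousOn c (Icc a b)) :
    IntervalIntegrable (fun r => A r (c r)) volume a b := by
  obtain ⟨C, hC⟩ := isCompact_Icc.exists_bound_of_continuousOn hc
  rw [intervalIntegrable_iff_integrableOn_Ioc_of_le hab] at hA ⊢
  apply Integrable.mono' (hA.norm.mul_const C)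
  · exact aesm_apply hA.1 ((hc.mono Ioc_subset_Icc_self).aestronglyMeasurable measurableSet_Ioc)
  · filter_upwards [ae_restrict_mem measurableSet_Ioc] with t ht
    exact (ContinuousLinearMap.le_opNorm _ _).trans (by gcongr; exact hC t (Ioc_subset_Icc_self ht))

theorem isPrim_int {f : ℝ → F} {a b : ℝ} (y0 : F) (hf : IntervalIntegrable f volume a b) :
    IsPrim (fun t => y0 + ∫ s in a..t, f s) f a b := ⟨hf, fun t ht => by simp⟩

theorem lin_exists [FiniteDimensional ℝ F] {A : ℝ → F →L[ℝ] F} {a b : ℝ} (hab : a ≤ b)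
    (hA : IntervalIntegrable A volume a b) (y0 : F) :
    ∃ y : ℝ → F, y a = y0 ∧ IsPrim y (fun t => A t (y t)) a b := by
  have : CompleteSpace F := FiniteDimensional.complete ℝ F
  let μ : ℝ → ℝ := fun t => ∫ s in a..t, ‖A s‖
  have hμ : IsPrim μ (fun s => ‖A s‖) a b := ⟨hA.norm, fun t ht => by simp [μ]⟩
  have hμc := hμ.cont hab
  have hμ0 : μ a = 0 := by simp [μ]
  have he : ContinuousOn (fun r => Real.exp (2 * μ r)) (Icc a b) := by fun_prop
  have he' : ContinuousOn (fun r => Real.exp (-(2 * μ r))) (Icc a b) := by fun_prop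
  let Y : C(Icc a b, F) → ℝ → F := fun y r => Real.exp (2 * μ r) • IccExtend hab y r
  have hYc : ∀ y, ContinuousOn (Y y) (Icc a b) := fun y =>
    he.smul (y.continuous.Icc_extend').continuousOn
  have hYi : ∀ y, IntervalIntegrable (fun r => A r (Y y r)) volume a b := fun y =>
    ii_apply hab hA (hYc y)
  have hexp : IsPrim (fun t => Real.exp (2 * μ t)) (fun t => 2 * (‖A t‖ * Real.exp (2 * μ t))) a b := by
    have := hμ.comp hab (g := fun x : ℝ => Real.exp (2 * x)) (by fun_prop)
    convert this using 2 with t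
    have h1 : HasDerivAt (fun x : ℝ => Real.exp (2 * x)) (Real.exp (2 * μ t) * (2 * 1)) (μ t) :=
      ((hasDerivAt_id _).const_mul 2).exp
    rw [h1.hasFDerivAt.fderiv]
    simp; ring
  have hTc : ∀ y, ContinuousOn (fun t => Real.exp (-(2 * μ t)) • (y0 + ∫ r in a..t, A r (Y y r))) (Icc a b) :=
    fun y => he'.smul ((isPrim_int y0 (hYi y)).cont hab)
  let T : C(Icc a b, F) → C(Icc a b, F) := fun y =>
    ⟨(Icc a b).domRestrict (fun t => Real.exp (-(2 * μ t)) • (y0 + ∫ r in a..t, A r (Y y r))),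
      (hTc y).domRestrict⟩
  have hcon : ContractingWith (1/2) T := by
    refine ⟨by rw [div_lt_one (by norm_num)]; norm_num, ?_⟩
    apply LipschitzWith.of_dist_le_mul
    intro y w
    rw [ContinuousMap.dist_le (by positivity)]
    rintro ⟨t, ht⟩
    have ha : a ∈ Icc a b := ⟨le_rfl, hab⟩
    have i1 := (isPrim_int y0 (hYi y)).ii ha ht
    have i2 := (isPrim_int y0 (hYi w)).ii ha ht
    simp only [T, ContinuousMap.coe_mk, domRestrict_apply]
    rw [dist_eq_norm, ← smul_sub, add_sub_add_left_eq_sub, ← intervalIntegral.integral_sub i1 i2, norm_smul,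
      Real.norm_of_nonneg (Real.exp_pos _).le]
    have hb : ‖∫ r in a..t, (A r (Y y r) - A r (Y w r))‖ ≤ ∫ r in a..t, dist y w / 2 * (2 * (‖A r‖ * Real.exp (2 * μ r))) := by
      apply intervalIntegral.norm_integral_le_of_norm_le ht.1
      · refine Eventually.of_forall fun r hr => ?_
        have hr' : r ∈ Icc a b := ⟨hr.1.le, hr.2.trans ht.2⟩
        rw [← map_sub]
        refine (ContinuousLinearMap.le_opNorm _ _).trans ?_
        simp only [Y, ← smul_sub, norm_smul, Real.norm_of_nonneg (Real.exp_pos (2 * μ r)).le]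
        rw [IccExtend_of_mem _ _ hr', IccExtend_of_mem _ _ hr', ← dist_eq_norm]
        have := ContinuousMap.dist_apply_le_dist (f := y) (g := w) ⟨r, hr'⟩
        calc _ ≤ ‖A r‖ * (Real.exp (2 * μ r) * dist y w) := by gcongr
          _ = _ := by ring
      · exact (hexp.ii ha ht).const_mul _
    rw [intervalIntegral.integral_const_mul] at hb
    have h2 := hexp.2 t ht
    simp only [hμ0, mul_zero, Real.exp_zero] at h2
    rw [show ∫ r in a..t, 2 * (‖A r‖ * Real.exp (2 * μ r)) = Real.exp (2 * μ t) - 1 by linarith] at hb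
    calc _ ≤ Real.exp (-(2 * μ t)) * (dist y w / 2 * (Real.exp (2 * μ t) - 1)) := by gcongr
      _ = dist y w / 2 * (Real.exp (-(2 * μ t)) * Real.exp (2 * μ t) - Real.exp (-(2 * μ t))) := by ring
      _ = dist y w / 2 * (1 - Real.exp (-(2 * μ t))) := by rw [← Real.exp_add]; simp
      _ ≤ dist y w / 2 * 1 := by gcongr; linarith [Real.exp_pos (-(2 * μ t))]
      _ = _ := by push_cast; ring
  have : Nonempty (C(Icc a b, F)) := ⟨0⟩
  let y := hcon.fixedPoint
  have hy : T y = y := hcon.fixedPoint_isFixedPt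
  have hYeq : ∀ t ∈ Icc a b, y0 + ∫ r in a..t, A r (Y y r) = Y y t := by
    intro t ht
    have h1 := congrArg (fun f : C(Icc a b, F) => f ⟨t, ht⟩) hy
    simp only [T, ContinuousMap.coe_mk, domRestrict_apply] at h1
    simp only [Y, IccExtend_of_mem _ _ ht]
    rw [← h1, smul_smul, ← Real.exp_add]
    simp [Y]
  have hp := (isPrim_int y0 (hYi y)).congr_left hab hYeq
  refine ⟨Y y, ?_, hp⟩
  rw [← hYeq a ⟨le_rfl, hab⟩]; simp

theorem alg_fund {𝔸 : Type*} [NormedRing 𝔸] [NormedAlgebra ℝ 𝔸] [FiniteDimensional ℝ 𝔸] {A : ℝ → 𝔸} {a b : ℝ} (hab : a ≤ b)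
    (hA : IntervalIntegrable A volume a b) :
    ∃ M N : ℝ → 𝔸, M a = 1 ∧ N a = 1 ∧ IsPrim M (fun t => A t * M t) a b ∧
      IsPrim N (fun t => -(N t * A t)) a b ∧ (∀ t ∈ Icc a b, N t * M t = 1) := by
  have : CompleteSpace 𝔸 := FiniteDimensional.complete ℝ 𝔸
  let Lm := ContinuousLinearMap.mul ℝ 𝔸
  have hA1 : IntervalIntegrable (fun t => Lm (A t)) volume a b :=
    ⟨Lm.integrable_comp hA.1, Lm.integrable_comp hA.2⟩
  have hA2 : IntervalIntegrable (fun t => - Lm.flip (A t)) volume a b :=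
    IntervalIntegrable.neg (f := fun t => Lm.flip (A t)) ⟨Lm.flip.integrable_comp hA.1, Lm.flip.integrable_comp hA.2⟩
  obtain ⟨M, hMa, hM⟩ := lin_exists hab hA1 1
  obtain ⟨N, hNa, hN⟩ := lin_exists hab hA2 1
  have hNM : ∀ t ∈ Icc a b, N t * M t = 1 := by
    intro t ht
    have h1 := (hN.bilin hM hab Lm).2 t ht
    simp [Lm, hMa, hNa, mul_assoc] at h1
    exact h1
  exact ⟨M, N, hMa, hNa, hM, hN, hNM⟩

theorem fund_exists [FiniteDimensional ℝ F] {A : ℝ → F →L[ℝ] F} {a b : ℝ} (hab : a ≤ b)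
    (hA : IntervalIntegrable A volume a b) :
    ∃ M N : ℝ → F →L[ℝ] F, M a = 1 ∧ N a = 1 ∧ IsPrim M (fun t => A t * M t) a b ∧
      IsPrim N (fun t => -(N t * A t)) a b ∧ (∀ t ∈ Icc a b, N t * M t = 1) ∧
      ∀ t ∈ Icc a b, M t * N t = 1 := by
  obtain ⟨M, N, hMa, hNa, hM, hN, hNM⟩ := alg_fund hab hA
  refine ⟨M, N, hMa, hNa, hM, hN, hNM, fun t ht => ?_⟩
  have h2 := hNM t ht
  have : (N t).toLinearMap * (M t).toLinearMap = 1 := by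
    ext x; simpa using congrArg (fun L : F →L[ℝ] F => L x) h2
  have h3 := mul_eq_one_comm.1 this
  ext x
  exact congrArg (fun L : F →ₗ[ℝ] F => L x) h3
end
end

section

section
variable {G : Type*} [NormedAddCommGroup G] [NormedSpace ℝ G]

theorem quad_est {f : G → G} {m : ℝ} (hm : 0 ≤ m) (hd : Differentiable ℝ f)
    (h2 : ∀ z w, ‖fderiv ℝ f z - fderiv ℝ f w‖ ≤ m * ‖z - w‖) (z w : G) :
    ‖f w - f z - fderiv ℝ f z (w - z)‖ ≤ m * ‖w - z‖ * ‖w - z‖ := by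
  apply (convex_segment z w).norm_image_sub_le_of_norm_fderiv_le' (fun x _ => hd x) ?_
    (left_mem_segment ℝ z w) (right_mem_segment ℝ z w)
  intro x hx
  refine (h2 _ _).trans ?_
  gcongr
  obtain ⟨θ, hθ, rfl⟩ := (segment_eq_image' ℝ z w ▸ hx)
  simp only [add_sub_cancel_left, norm_smul, Real.norm_of_nonneg hθ.1]
  exact mul_le_of_le_one_left (norm_nonneg _) hθ.2

theorem lip_est {f : G → G} {m : ℝ} (hd : Differentiable ℝ f)
    (h1 : ∀ z, ‖fderiv ℝ f z‖ ≤ m) (z w : G) :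
    ‖f w - f z‖ ≤ m * ‖w - z‖ := 
  convex_univ.norm_image_sub_le_of_norm_fderiv_le (fun x _ => hd x) (fun x _ => h1 x) (mem_univ z) (mem_univ w)

theorem pert {F U : ℝ → G → G} {m : ℝ → ℝ} {a b ε : ℝ} (hab : a ≤ b) (hm0 : ∀ t, 0 ≤ m t)
    (hm : IntervalIntegrable m volume a b)
    (hF0 : ∀ r, Differentiable ℝ (F r)) (hF1 : ∀ r z, ‖fderiv ℝ (F r) z‖ ≤ m r)
    (hF2 : ∀ r z w, ‖fderiv ℝ (F r) z - fderiv ℝ (F r) w‖ ≤ m r * ‖z - w‖)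
    (hU0 : ∀ r z, ‖U r z‖ ≤ m r) (hU1 : ∀ r z w, ‖U r w - U r z‖ ≤ m r * ‖w - z‖)
    {z y δ : ℝ → G} (hz : IsPrim z (fun r => F r (z r)) a b)
    (hy : IsPrim y (fun r => F r (y r) + ε • U r (y r)) a b)
    (hδ : IsPrim δ (fun r => fderiv ℝ (F r) (z r) (δ r) + ε • U r (z r)) a b)
    (hδa : δ a = y a - z a) {κ I : ℝ} (hI : I = ∫ r in a..b, m r)
    (hκ : κ = (‖y a - z a‖ + |ε| * I) * Real.exp I) (t : ℝ) (ht : t ∈ Icc a b) :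
    ‖y t - z t - δ t‖ ≤ (κ ^ 2 + |ε| * κ) * I * Real.exp I := by
  have ha : a ∈ Icc a b := ⟨le_rfl, hab⟩
  have hzc := hz.cont hab
  have hyc := hy.cont hab
  have hδc := hδ.cont hab
  have hit : ∀ t ∈ Icc a b, IntervalIntegrable m volume a t := fun t ht =>
    hm.mono_set (by rw [uIcc_of_le ht.1, uIcc_of_le hab]; exact Icc_subset_Icc_right ht.2)
  have hIt : ∀ t ∈ Icc a b, 0 ≤ ∫ r in a..t, m r := fun t ht =>
    intervalIntegral.integral_nonneg ht.1 (fun r _ => hm0 r)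
  have hIle : ∀ t ∈ Icc a b, ∫ r in a..t, m r ≤ I := fun t ht => by
    rw [hI]
    apply intervalIntegral.integral_mono_interval le_rfl ht.1 ht.2 (Eventually.of_forall hm0) hm
  have hI0 : 0 ≤ I := (hIt t ht).trans (hIle t ht)
  have hEc : ContinuousOn (fun t => ‖y t - z t‖) (Icc a b) := (hyc.sub hzc).norm
  have hRc : ContinuousOn (fun t => ‖y t - z t - δ t‖) (Icc a b) := ((hyc.sub hzc).sub hδc).norm
  have step1 : ∀ t ∈ Icc a b, ‖y t - z t‖ ≤ κ := by
    intro t ht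
    have hg := gronwall_int (C := ‖y a - z a‖ + |ε| * I) hEc hm hm0 (fun t ht => ?_) t ht
    · refine hg.trans ?_
      rw [hκ]
      gcongr
      exact hIle t ht
    · have e1 : y t - z t = (y a - z a) + ∫ r in a..t, (F r (y r) + ε • U r (y r) - F r (z r)) := by
        rw [intervalIntegral.integral_sub (hy.ii ha ht) (hz.ii ha ht), hy.2 t ht, hz.2 t ht]; abel
      have hmE : IntervalIntegrable (fun s => m s * ‖y s - z s‖) volume a t :=
        (hit t ht).mul_continuousOn (by rw [uIcc_of_le ht.1]; exact hEc.mono (Icc_subset_Icc_right ht.2))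
      have e2 : ‖∫ r in a..t, (F r (y r) + ε • U r (y r) - F r (z r))‖ ≤
          ∫ r in a..t, (|ε| * m r + m r * ‖y r - z r‖) := by
        apply intervalIntegral.norm_integral_le_of_norm_le ht.1
        · refine Eventually.of_forall fun r hr => ?_
          have := lip_est (hF0 r) (hF1 r) (z r) (y r)
          have h2 := hU0 r (y r)
          calc _ = ‖ε • U r (y r) + (F r (y r) - F r (z r))‖ := by congr 1; abel
            _ ≤ ‖ε • U r (y r)‖ + _ := norm_add_le _ _
            _ ≤ _ := by rw [norm_smul, Real.norm_eq_abs]; gcongr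
        · exact ((hit t ht).const_mul _).add hmE
      rw [intervalIntegral.integral_add ((hit t ht).const_mul _) hmE, intervalIntegral.integral_const_mul] at e2
      rw [e1]
      refine (norm_add_le _ _).trans ?_
      have : |ε| * ∫ r in a..t, m r ≤ |ε| * I := by gcongr; exact hIle t ht
      linarith
  have hκ0 : 0 ≤ κ := (norm_nonneg _).trans (step1 t ht)
  have hg := gronwall_int (C := (κ ^ 2 + |ε| * κ) * I) hRc hm hm0 (fun t ht => ?_) t ht
  · refine hg.trans ?_
    gcongr
    exact hIle t ht
  · have e1 : y t - z t - δ t = ∫ r in a..t, (F r (y r) + ε • U r (y r) - F r (z r) - (fderiv ℝ (F r) (z r) (δ r) + ε • U r (z r))) := by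
      rw [intervalIntegral.integral_sub ((hy.ii ha ht).sub (hz.ii ha ht)) (hδ.ii ha ht), intervalIntegral.integral_sub (hy.ii ha ht) (hz.ii ha ht), hy.2 t ht, hz.2 t ht, hδ.2 t ht, hδa]; abel
    have hmE : IntervalIntegrable (fun s => m s * ‖y s - z s - δ s‖) volume a t :=
      (hit t ht).mul_continuousOn (by rw [uIcc_of_le ht.1]; exact hRc.mono (Icc_subset_Icc_right ht.2))
    have e2 : ‖∫ r in a..t, (F r (y r) + ε • U r (y r) - F r (z r) - (fderiv ℝ (F r) (z r) (δ r) + ε • U r (z r)))‖ ≤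
        ∫ r in a..t, ((κ ^ 2 + |ε| * κ) * m r + m r * ‖y r - z r - δ r‖) := by
      apply intervalIntegral.norm_integral_le_of_norm_le ht.1
      · refine Eventually.of_forall fun r hr => ?_
        have hs := step1 r ⟨hr.1.le, hr.2.trans ht.2⟩
        have h1 := quad_est (hm0 r) (hF0 r) (hF2 r) (z r) (y r)
        have h2 := hU1 r (z r) (y r)
        have h3 : ‖fderiv ℝ (F r) (z r) (y r - z r - δ r)‖ ≤ m r * ‖y r - z r - δ r‖ :=
          (ContinuousLinearMap.le_opNorm _ _).trans (by gcongr; exact hF1 r _)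
        have hmr := hm0 r
        calc _ = ‖(F r (y r) - F r (z r) - fderiv ℝ (F r) (z r) (y r - z r)) + 
              ε • (U r (y r) - U r (z r)) + fderiv ℝ (F r) (z r) (y r - z r - δ r)‖ := by
              congr 1; rw [map_sub _ _ (δ r), smul_sub]; abel
          _ ≤ m r * ‖y r - z r‖ * ‖y r - z r‖ + |ε| * (m r * ‖y r - z r‖) + m r * ‖y r - z r - δ r‖ := by
              refine (norm_add₃_le).trans ?_
              rw [norm_smul, Real.norm_eq_abs]
              gcongr
          _ ≤ m r * κ * κ + |ε| * (m r * κ) + m r * ‖y r - z r - δ r‖ := by gcongr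
          _ = _ := by ring
      · exact ((hit t ht).const_mul _).add hmE
    rw [intervalIntegral.integral_add ((hit t ht).const_mul _) hmE, intervalIntegral.integral_const_mul] at e2
    rw [e1]
    refine e2.trans ?_
    gcongr
    exact hIle t ht

theorem pert_space {F : ℝ → G → G} {m : ℝ → ℝ} {a₀ a b : ℝ} (ha₀ : a₀ ≤ a) (hab : a ≤ b) (hm0 : ∀ t, 0 ≤ m t)
    [FiniteDimensional ℝ G]
    (hm : IntervalIntegrable m volume a b)
    (hF0 : ∀ r, Differentiable ℝ (F r)) (hF1 : ∀ r z, ‖fderiv ℝ (F r) z‖ ≤ m r)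
    (hF2 : ∀ r z w, ‖fderiv ℝ (F r) z - fderiv ℝ (F r) w‖ ≤ m r * ‖z - w‖)
    {z y : ℝ → G} {M N : ℝ → G →L[ℝ] G} (hz : IsPrim z (fun r => F r (z r)) a b)
    (hy : IsPrim y (fun r => F r (y r)) a b)
    (hM : IsPrim M (fun r => fderiv ℝ (F r) (z r) * M r) a₀ b)
    (hMN : M a * N a = 1) {I : ℝ} (hI : I = ∫ r in a..b, m r) (t : ℝ) (ht : t ∈ Icc a b) :
    ‖y t - z t - (M t * N a) (y a - z a)‖ ≤ (Real.exp I ^ 2 * I * Real.exp I) * ‖y a - z a‖ ^ 2 := by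
  have : CompleteSpace G := FiniteDimensional.complete ℝ G
  have h1 : IsPrim (fun r => (M r * N a) (y a - z a)) (fun r => fderiv ℝ (F r) (z r) ((M r * N a) (y a - z a)) + (0:ℝ) • (0 : G)) a b := by
    have := (hM.mono (s := a) (t := b) ⟨ha₀, hab⟩ ⟨ha₀.trans hab, le_rfl⟩).clm (ContinuousLinearMap.apply ℝ G (N a (y a - z a)))
    simpa using this
  have := pert (U := fun _ _ => 0) (ε := 0) hab hm0 hm hF0 hF1 hF2 (by simpa using hm0) (by intro r z w; simp; have := hm0 r; positivity)
    hz (by simpa using hy) h1 (by rw [hMN]; simp) hI rfl t ht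
  refine this.trans (le_of_eq ?_)
  simp; ring

theorem pert_time {F U : ℝ → G → G} {m : ℝ → ℝ} {a b ε : ℝ} (hab : a ≤ b) (hm0 : ∀ t, 0 ≤ m t)
    [FiniteDimensional ℝ G]
    (hm : IntervalIntegrable m volume a b)
    (hF0 : ∀ r, Differentiable ℝ (F r)) (hF1 : ∀ r z, ‖fderiv ℝ (F r) z‖ ≤ m r)
    (hF2 : ∀ r z w, ‖fderiv ℝ (F r) z - fderiv ℝ (F r) w‖ ≤ m r * ‖z - w‖)
    (hU0 : ∀ r z, ‖U r z‖ ≤ m r) (hU1 : ∀ r z w, ‖U r w - U r z‖ ≤ m r * ‖w - z‖)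
    {z y : ℝ → G} (hz : IsPrim z (fun r => F r (z r)) a b)
    (hy : IsPrim y (fun r => F r (y r) + ε • U r (y r)) a b) (hyz : y a = z a)
    {M N : ℝ → G →L[ℝ] G}
    (hM : IsPrim M (fun r => fderiv ℝ (F r) (z r) * M r) a b)
    (hNc : ContinuousOn N (Icc a b))
    (hMN : ∀ t ∈ Icc a b, M t * N t = 1) (hUi : IntervalIntegrable (fun r => U r (z r)) volume a b)
    {I : ℝ} (hI : I = ∫ r in a..b, m r) :
    ‖y b - z b - ε • M b (∫ s in a..b, N s (U s (z s)))‖ ≤ ((I * Real.exp I) ^ 2 + I * Real.exp I) * I * Real.exp I * ε ^ 2 := by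
  have : CompleteSpace G := FiniteDimensional.complete ℝ G
  have hNU : IntervalIntegrable (fun s => N s (U s (z s))) volume a b := by
    obtain ⟨C, hC⟩ := isCompact_Icc.exists_bound_of_continuousOn hNc
    rw [intervalIntegrable_iff_integrableOn_Ioc_of_le hab] at hUi ⊢
    apply Integrable.mono' (hUi.norm.const_mul C)
    · exact aesm_apply ((hNc.mono Ioc_subset_Icc_self).aestronglyMeasurable measurableSet_Ioc) hUi.1
    · filter_upwards [ae_restrict_mem measurableSet_Ioc] with t ht
      exact (ContinuousLinearMap.le_opNorm _ _).trans (by gcongr; exact hC t (Ioc_subset_Icc_self ht))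
  have hw := (isPrim_int (ε • (0:G)) (hNU.smul ε))
  have hδ := (hM.bilin hw hab (ContinuousLinearMap.apply ℝ G).flip).congr' hab
    (z' := fun r => fderiv ℝ (F r) (z r) (M r (ε • (0:G) + ∫ s in a..r, ε • N s (U s (z s)))) + ε • U r (z r)) (by
      intro t ht
      have := hMN t ht
      have h3 : M t (N t (U t (z t))) = U t (z t) := by
        rw [← mul_apply_eq_comp, this]; simp
      simp [h3, add_comm])
  have := pert hab hm0 hm hF0 hF1 hF2 hU0 hU1 hz hy hδ (by simp [hyz]) hI rfl b ⟨hab, le_rfl⟩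
  simp only [hyz, sub_self, norm_zero, zero_add] at this
  have e : ∫ s in a..b, ε • N s (U s (z s)) = ε • ∫ s in a..b, N s (U s (z s)) := 
    intervalIntegral.integral_smul _ _
  simp only [smul_zero, zero_add, ContinuousLinearMap.flip_apply, ContinuousLinearMap.apply_apply, Pi.smul_apply, e, map_smul] at this
  refine this.trans (le_of_eq ?_)
  rw [← sq_abs ε]
  ring
end
end

section

section
variable {E : Type} [NormedAddCommGroup E] [NormedSpace ℝ E]

theorem ind_le {F : Type} [NormedAddCommGroup F] [NormedSpace ℝ F] {Ω : Set E} (hΩ : IsOpen Ω) {g : E → F} (hc : Continuous (indicator Ω g))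
    (hd : ∀ x ∈ Ω, DifferentiableAt ℝ g x) {x y : E} {C : ℝ} (hC : ∀ w ∈ segment ℝ y x, w ∈ Ω → ‖fderiv ℝ g w‖ ≤ C)
    (hx : x ∉ Ω) (hy : y ∈ Ω) (hC0 : 0 ≤ C) : ‖g y‖ ≤ C * ‖y - x‖ := by
  let γ : ℝ → E := fun s => y + s • (x - y)
  have hγ : Continuous γ := by fun_prop
  let S := Icc (0:ℝ) 1 ∩ γ ⁻¹' Ωᶜ
  have hS : IsCompact S := isCompact_Icc.inter_right (hΩ.isClosed_compl.preimage hγ)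
  have hSn : S.Nonempty := ⟨1, ⟨by norm_num, le_rfl⟩, by simpa [γ] using hx⟩
  obtain ⟨σ, hσ⟩ := hS.exists_isLeast hSn
  have hσS := hσ.1
  have hin : ∀ s ∈ Ico 0 σ, γ s ∈ Ω := by
    intro s hs
    by_contra h
    exact absurd (hσ.2 ⟨⟨hs.1, hs.2.le.trans hσS.1.2⟩, h⟩) (not_le.2 hs.2)
  have key := norm_image_sub_le_of_norm_deriv_right_le_segment (f := fun s => indicator Ω g (γ s))
    (f' := fun s => fderiv ℝ g (γ s) (x - y)) (a := 0) (b := σ) (C := C * ‖x - y‖)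
    (hc.comp hγ).continuousOn ?_ ?_ σ ⟨hσS.1.1, le_rfl⟩
  · have h1 : indicator Ω g (γ σ) = 0 := indicator_of_notMem hσS.2 _
    have h2 : γ 0 = y := by simp [γ]
    simp only [h1, h2, indicator_of_mem hy, zero_sub, norm_neg, sub_zero] at key
    rw [norm_sub_rev]
    exact key.trans (mul_le_of_le_one_right (by positivity) hσS.1.2)
  · intro s hs
    have hm := hin s hs
    have h1 : HasFDerivAt (indicator Ω g) (fderiv ℝ g (γ s)) (γ s) := by
      apply (hd _ hm).hasFDerivAt.congr_of_eventuallyEq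
      filter_upwards [hΩ.mem_nhds hm] with w hw using indicator_of_mem hw _
    have h2 : HasDerivAt γ (x - y) s := by
      have := ((hasDerivAt_id s).smul_const (x - y)).const_add y
      rw [one_smul] at this
      exact this
    exact (h1.comp_hasDerivAt s h2).hasDerivWithinAt
  · intro s hs
    refine (ContinuousLinearMap.le_opNorm _ _).trans ?_
    gcongr
    apply hC _ _ (hin s hs)
    rw [segment_eq_image']
    exact ⟨s, ⟨hs.1, hs.2.le.trans hσS.1.2⟩, rfl⟩

theorem ind_cont {F : Type} [NormedAddCommGroup F] [NormedSpace ℝ F] {Ω : Set E} (hΩ : IsOpen Ω) {g : E → F} 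
    (hg : ContinuousOn g Ω) (h : ∀ x ∈ frontier Ω, Tendsto (fun y => ‖g y‖) (𝓝[Ω] x) (𝓝 0)) :
    Continuous (indicator Ω g) := by
  rw [continuous_iff_continuousAt]
  intro x
  by_cases hx : x ∈ Ω
  · apply (hg.continuousAt (hΩ.mem_nhds hx)).congr
    filter_upwards [hΩ.mem_nhds hx] with w hw using (indicator_of_mem hw _).symm
  by_cases hx' : x ∈ closure Ω
  · have hf : x ∈ frontier Ω := by rw [hΩ.frontier_eq]; exact ⟨hx', hx⟩
    have := h x hf
    rw [ContinuousAt, indicator_of_notMem hx, tendsto_zero_iff_norm_tendsto_zero]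
    rw [Metric.tendsto_nhdsWithin_nhds] at this
    rw [Metric.tendsto_nhds_nhds]
    intro ε hε
    obtain ⟨δ, hδ, h3⟩ := this ε hε
    refine ⟨δ, hδ, fun y hy => ?_⟩
    by_cases hyΩ : y ∈ Ω
    · rw [indicator_of_mem hyΩ]; exact h3 hyΩ hy
    · rw [indicator_of_notMem hyΩ]; simpa using hε
  · have : (fun _ => (0:F)) =ᶠ[𝓝 x] indicator Ω g := by
      filter_upwards [isClosed_closure.isOpen_compl.mem_nhds hx'] with w hw
      rw [indicator_of_notMem (fun h => hw (subset_closure h))]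
    exact continuousAt_const.congr this

theorem ind_contDiff {Ω : Set E} (hΩ : IsOpen Ω) (k : ℕ) : ∀ {F : Type} [NormedAddCommGroup F] [NormedSpace ℝ F] {g : E → F} 
    (_ : ContDiffOn ℝ k g Ω) (_ : ∀ j ≤ k, ∀ x ∈ frontier Ω, Tendsto (fun y => ‖iteratedFDeriv ℝ j g y‖) (𝓝[Ω] x) (𝓝 0)),
    ContDiff ℝ k (indicator Ω g) := by
  induction k with
  | zero =>
    intro F _ _ g hg h
    rw [Nat.cast_zero, contDiff_zero]
    exact ind_cont hΩ hg.continuousOn (by simpa using h 0 le_rfl)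
  | succ k ih =>
    intro F _ _ g hg h
    have hc := ind_cont hΩ hg.continuousOn (by simpa using h 0 (Nat.zero_le _))
    have hd : ∀ x ∈ Ω, DifferentiableAt ℝ g x := fun x hx =>
      (hg.differentiableOn (by simp)).differentiableAt (hΩ.mem_nhds hx)
    have h1 : ∀ x, HasFDerivAt (indicator Ω g) (indicator Ω (fderiv ℝ g) x) x := by
      intro x
      by_cases hx : x ∈ Ω
      · rw [indicator_of_mem hx]
        apply (hd _ hx).hasFDerivAt.congr_of_eventuallyEq
        filter_upwards [hΩ.mem_nhds hx] with w hw using indicator_of_mem hw _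
      rw [indicator_of_notMem hx]
      by_cases hx' : x ∈ closure Ω
      · have hf : x ∈ frontier Ω := by rw [hΩ.frontier_eq]; exact ⟨hx', hx⟩
        have h2 := h 1 (by omega) x hf
        rw [hasFDerivAt_iff_isLittleO, Asymptotics.isLittleO_iff]
        intro ε hε
        have h3 := (Metric.tendsto_nhdsWithin_nhds.1 h2) ε hε
        obtain ⟨δ, hδ, h3⟩ := h3
        filter_upwards [Metric.ball_mem_nhds x hδ] with y hy
        simp only [indicator_of_notMem hx, sub_zero, zero_apply]
        by_cases hyΩ : y ∈ Ω
        · rw [indicator_of_mem hyΩ]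
          apply ind_le hΩ hc hd _ hx hyΩ hε.le
          intro w hw hwΩ
          have hwb : w ∈ Metric.ball x δ := (convex_ball x δ).segment_subset hy (Metric.mem_ball_self hδ) hw
          have := h3 hwΩ hwb
          simp only [dist_zero_right, norm_norm] at this
          rw [← norm_iteratedFDeriv_one]
          exact this.le
        · rw [indicator_of_notMem hyΩ, norm_zero]; positivity
      · apply (hasFDerivAt_const (0:F) x).congr_of_eventuallyEq
        filter_upwards [isClosed_closure.isOpen_compl.mem_nhds hx'] with w hw
        rw [indicator_of_notMem (fun h => hw (subset_closure h))]
    have h2 : fderiv ℝ (indicator Ω g) = indicator Ω (fderiv ℝ g) := funext fun x => (h1 x).fderiv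
    rw [Nat.cast_add, Nat.cast_one, contDiff_succ_iff_fderiv]
    refine ⟨fun x => (h1 x).differentiableAt, by simp, ?_⟩
    rw [h2]
    apply ih
    · exact hg.fderiv_of_isOpen hΩ (by norm_cast)
    · intro j hj x hx
      have := h (j+1) (by omega) x hx
      simpa only [norm_iteratedFDeriv_fderiv] using this

end

theorem ext_bound {d : ℕ} {Ω : Set (Euc d)} (hΩ : IsOpen Ω) (hΩb : Bornology.IsBounded Ω) {f : Euc d → Euc d}
    (h : MemC0k 3 Ω f) :
    ContDiff ℝ 3 (indicator Ω f) ∧ ∀ j ≤ 3, ∀ x, ‖iteratedFDeriv ℝ j (indicator Ω f) x‖ ≤ CknormOn 3 Ω f := by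
  have hcd : ContDiff ℝ 3 (indicator Ω f) := ind_contDiff hΩ 3 h.1 (fun j hj x hx => by
    simpa using (h.2 j hj x hx).norm)
  refine ⟨hcd, fun j hj x => ?_⟩
  have heq : ∀ i, ∀ x ∈ Ω, iteratedFDeriv ℝ i (indicator Ω f) x = iteratedFDeriv ℝ i f x := by
    intro i x hx
    have he : indicator Ω f =ᶠ[𝓝 x] f := by
      filter_upwards [hΩ.mem_nhds hx] with w hw using indicator_of_mem hw _
    exact (EventuallyEq.iteratedFDeriv ℝ he i).eq_of_nhds
  have hcont : ∀ i ≤ 3, Continuous (iteratedFDeriv ℝ i (indicator Ω f)) := fun i hi =>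
    hcd.continuous_iteratedFDeriv (by exact_mod_cast hi)
  have hnn : ∀ i, 0 ≤ ⨆ x ∈ Ω, ‖iteratedFDeriv ℝ i f x‖ := fun i =>
    Real.iSup_nonneg fun x => Real.iSup_nonneg fun _ => norm_nonneg _
  have hle : ∀ x ∈ Ω, ‖iteratedFDeriv ℝ j f x‖ ≤ CknormOn 3 Ω f := by
    intro x hx
    have h1 : ‖iteratedFDeriv ℝ j f x‖ ≤ ⨆ x ∈ Ω, ‖iteratedFDeriv ℝ j f x‖ := by
      obtain ⟨B, hB⟩ := hΩb.isCompact_closure.exists_bound_of_continuousOn (hcont j hj).continuousOn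
      have hbd : BddAbove (range fun x => ⨆ (_ : x ∈ Ω), ‖iteratedFDeriv ℝ j f x‖) := by
        refine ⟨max B 0, ?_⟩
        rintro _ ⟨y, rfl⟩
        apply Real.iSup_le _ (le_max_right _ _)
        intro hy
        rw [← heq j y hy]
        exact (hB y (subset_closure hy)).trans (le_max_left _ _)
      have := le_ciSup hbd x
      simpa [hx] using this
    refine h1.trans ?_
    exact Finset.single_le_sum (f := fun j => ⨆ x ∈ Ω, ‖iteratedFDeriv ℝ j f x‖) (fun i _ => hnn i) (by simp; omega)
  have hC0 : 0 ≤ CknormOn 3 Ω f := Finset.sum_nonneg fun i _ => hnn i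
  have hcl : IsClosed {x | ‖iteratedFDeriv ℝ j (indicator Ω f) x‖ ≤ CknormOn 3 Ω f} :=
    isClosed_le (hcont j hj).norm continuous_const
  by_cases hx : x ∈ closure Ω
  · exact closure_minimal (s := Ω) (fun y hy => by simpa [heq j y hy] using hle y hy) hcl hx
  · have : indicator Ω f =ᶠ[𝓝 x] fun _ => 0 := by
      filter_upwards [isClosed_closure.isOpen_compl.mem_nhds hx] with w hw
      rw [indicator_of_notMem (fun h => hw (subset_closure h))]
    rw [(EventuallyEq.iteratedFDeriv ℝ this j).eq_of_nhds]
    simpa using hC0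
end

section

structure Nice {V : Type*} [NormedAddCommGroup V] [NormedSpace ℝ V] {G : Type*} [NormedAddCommGroup G] [NormedSpace ℝ G]
    (T : V → G → G) (C : ℝ) : Prop where
  C0 : 0 ≤ C
  lin : ∀ (f g : V) (a : ℝ) (z : G), T (f + a • g) z = T f z + a • T g z
  diff : ∀ f, Differentiable ℝ (T f)
  b0 : ∀ f z, ‖T f z‖ ≤ C * ‖f‖
  b1 : ∀ f z, ‖fderiv ℝ (T f) z‖ ≤ C * ‖f‖
  b2 : ∀ f z w, ‖fderiv ℝ (T f) z - fderiv ℝ (T f) w‖ ≤ C * ‖f‖ * ‖z - w‖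

section
variable {V : Type*} [NormedAddCommGroup V] [NormedSpace ℝ V] {G : Type*} [NormedAddCommGroup G] [NormedSpace ℝ G]
variable {T : V → G → G} {C : ℝ}

theorem Nice.sub (h : Nice T C) (f g : V) : T f = T (f - g) + T g := by
  ext1 z
  have := h.lin (f - g) g 1 z
  simpa using this

theorem Nice.lip (h : Nice T C) (f : V) (z w : G) : ‖T f w - T f z‖ ≤ C * ‖f‖ * ‖w - z‖ :=
  lip_est (h.diff f) (h.b1 f) z w

theorem Nice.cont0 (h : Nice T C) : Continuous (fun p : V × G => T p.1 p.2) := by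
  rw [continuous_iff_continuousAt]
  rintro ⟨f, z⟩
  rw [ContinuousAt, tendsto_iff_norm_sub_tendsto_zero]
  apply squeeze_zero (fun _ => norm_nonneg _) (g := fun p : V × G => C * ‖p.1 - f‖ + C * ‖f‖ * ‖p.2 - z‖)
  · rintro ⟨g, w⟩
    simp only
    rw [h.sub g f]
    calc _ = ‖T (g - f) w + (T f w - T f z)‖ := by congr 1; simp; abel
      _ ≤ _ := (norm_add_le _ _).trans (add_le_add (h.b0 _ _) (h.lip _ _ _))
  · have : Continuous (fun p : V × G => C * ‖p.1 - f‖ + C * ‖f‖ * ‖p.2 - z‖) := by fun_prop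
    simpa using this.tendsto (f, z)

theorem Nice.cont1 (h : Nice T C) : Continuous (fun p : V × G => fderiv ℝ (T p.1) p.2) := by
  rw [continuous_iff_continuousAt]
  rintro ⟨f, z⟩
  rw [ContinuousAt, tendsto_iff_norm_sub_tendsto_zero]
  apply squeeze_zero (fun _ => norm_nonneg _) (g := fun p : V × G => C * ‖p.1 - f‖ + C * ‖f‖ * ‖p.2 - z‖)
  · rintro ⟨g, w⟩
    simp only
    rw [h.sub g f, fderiv_add (h.diff _ _) (h.diff _ _)]
    calc _ = ‖fderiv ℝ (T (g - f)) w + (fderiv ℝ (T f) w - fderiv ℝ (T f) z)‖ := by congr 1; abel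
      _ ≤ _ := (norm_add_le _ _).trans (add_le_add (h.b1 _ _) (h.b2 _ _ _))
  · have : Continuous (fun p : V × G => C * ‖p.1 - f‖ + C * ‖f‖ * ‖p.2 - z‖) := by fun_prop
    simpa using this.tendsto (f, z)

theorem Nice.ii0 (h : Nice T C) {v : ℝ → V} {z : ℝ → G} {a b : ℝ} (hab : a ≤ b) (hv : StronglyMeasurable v)
    (hvi : IntervalIntegrable (fun t => ‖v t‖) volume a b) (hz : ContinuousOn z (Icc a b)) :
    IntervalIntegrable (fun r => T (v r) (z r)) volume a b := by
  rw [intervalIntegrable_iff_integrableOn_Ioc_of_le hab] at hvi ⊢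
  apply Integrable.mono' (hvi.const_mul C)
  · exact h.cont0.comp_aestronglyMeasurable (hv.aestronglyMeasurable.prodMk ((hz.mono Ioc_subset_Icc_self).aestronglyMeasurable measurableSet_Ioc))
  · exact Eventually.of_forall fun r => h.b0 _ _

theorem Nice.ii1 (h : Nice T C) {v : ℝ → V} {z : ℝ → G} {a b : ℝ} (hab : a ≤ b) (hv : StronglyMeasurable v)
    (hvi : IntervalIntegrable (fun t => ‖v t‖) volume a b) (hz : ContinuousOn z (Icc a b)) :
    IntervalIntegrable (fun r => fderiv ℝ (T (v r)) (z r)) volume a b := by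
  rw [intervalIntegrable_iff_integrableOn_Ioc_of_le hab] at hvi ⊢
  apply Integrable.mono' (hvi.const_mul C)
  · exact h.cont1.comp_aestronglyMeasurable (hv.aestronglyMeasurable.prodMk ((hz.mono Ioc_subset_Icc_self).aestronglyMeasurable measurableSet_Ioc))
  · exact Eventually.of_forall fun r => h.b1 _ _
end

/-- trace as a continuous linear map -/
def trL (d : ℕ) : (Euc d →L[ℝ] Euc d) →L[ℝ] ℝ :=
  LinearMap.toContinuousLinearMap ((LinearMap.trace ℝ (Euc d)).comp (ContinuousLinearMap.coeLM ℝ))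

theorem trL_apply {d : ℕ} (A : Euc d →L[ℝ] Euc d) : trL d A = LinearMap.trace ℝ (Euc d) (A : Euc d →ₗ[ℝ] Euc d) := rfl

theorem divg_eq {d : ℕ} (f : Euc d → Euc d) (x : Euc d) : divg f x = trL d (fderiv ℝ f x) := rfl

def QQ {d : ℕ} (f : Euc d → Euc d) : Euc d → Euc d × ℝ := fun x => (f x, divg f x)

theorem lip2 {E F : Type*} [NormedAddCommGroup E] [NormedSpace ℝ E] [NormedAddCommGroup F] [NormedSpace ℝ F]
    {g : E → F} {B : ℝ} (hg : ContDiff ℝ 2 g) (h : ∀ x, ‖iteratedFDeriv ℝ 2 g x‖ ≤ B) (x y : E) :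
    ‖fderiv ℝ g x - fderiv ℝ g y‖ ≤ B * ‖x - y‖ := by
  have c2 : ContDiff ℝ 1 (fderiv ℝ g) := hg.fderiv_right (by norm_num)
  refine convex_univ.norm_image_sub_le_of_norm_fderiv_le (fun x _ => c2.differentiable (by norm_num) x) (fun x _ => ?_) (mem_univ y) (mem_univ x)
  rw [← norm_iteratedFDeriv_one, norm_iteratedFDeriv_fderiv]; exact h x

theorem QQ_bounds {d : ℕ} {f : Euc d → Euc d} {B : ℝ} (hf : ContDiff ℝ 3 f)
    (hB : ∀ j ≤ 3, ∀ x, ‖iteratedFDeriv ℝ j f x‖ ≤ B) :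
    Differentiable ℝ (QQ f) ∧ (∀ x, ‖QQ f x‖ ≤ (1 + ‖trL d‖) * B) ∧
      (∀ x, ‖fderiv ℝ (QQ f) x‖ ≤ (1 + ‖trL d‖) * B) ∧
      (∀ x y, ‖fderiv ℝ (QQ f) x - fderiv ℝ (QQ f) y‖ ≤ (1 + ‖trL d‖) * B * ‖x - y‖) := by
  have hB0 : 0 ≤ B := (norm_nonneg _).trans (hB 0 (by norm_num) 0)
  set τ := ‖trL d‖ with hτ
  have hτ0 : 0 ≤ τ := norm_nonneg (trL d)
  have f0 : ∀ x, ‖f x‖ ≤ B := fun x => by simpa using hB 0 (by norm_num) x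
  have f1 : ∀ x, ‖fderiv ℝ f x‖ ≤ B := fun x => by
    simpa only [norm_iteratedFDeriv_one] using hB 1 (by norm_num) x
  have f2 : ∀ x, ‖fderiv ℝ (fderiv ℝ f) x‖ ≤ B := fun x => by
    rw [← norm_iteratedFDeriv_one, norm_iteratedFDeriv_fderiv]; exact hB 2 (by norm_num) x
  have c1 : ContDiff ℝ 2 (fderiv ℝ f) := hf.fderiv_right (by norm_num)
  have d0 : Differentiable ℝ f := hf.differentiable (by norm_num)
  have d1 : Differentiable ℝ (fderiv ℝ f) := c1.differentiable (by norm_num)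
  have l1 : ∀ x y, ‖fderiv ℝ f x - fderiv ℝ f y‖ ≤ B * ‖x - y‖ := fun x y =>
    lip2 (hf.of_le (by norm_num)) (hB 2 (by norm_num)) x y
  have l2 : ∀ x y, ‖fderiv ℝ (fderiv ℝ f) x - fderiv ℝ (fderiv ℝ f) y‖ ≤ B * ‖x - y‖ := fun x y =>
    lip2 c1 (fun x => by rw [norm_iteratedFDeriv_fderiv]; exact hB 3 (by norm_num) x) x y
  have hQ : ∀ x, HasFDerivAt (QQ f) ((fderiv ℝ f x).prod ((trL d).comp (fderiv ℝ (fderiv ℝ f) x))) x := fun x =>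
    (d0 x).hasFDerivAt.prodMk ((trL d).hasFDerivAt.comp x (d1 x).hasFDerivAt)
  have hle1 : ∀ s, 0 ≤ s → s ≤ (1 + τ) * s := fun s hs => by nlinarith [mul_nonneg hτ0 hs]
  have hle2 : ∀ s, 0 ≤ s → τ * s ≤ (1 + τ) * s := fun s hs => by linarith
  refine ⟨fun x => (hQ x).differentiableAt, fun x => ?_, fun x => ?_, fun x y => ?_⟩
  · rw [QQ, Prod.norm_mk]
    apply max_le ((f0 x).trans (hle1 B hB0))
    rw [divg_eq]
    exact ((trL d).le_opNorm _).trans ((by gcongr; exact f1 x : _ ≤ τ * B).trans (hle2 B hB0))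
  · rw [(hQ x).fderiv]
    apply ContinuousLinearMap.opNorm_le_bound _ (by positivity)
    intro h
    rw [ContinuousLinearMap.prod_apply, Prod.norm_mk]
    apply max_le
    · refine (ContinuousLinearMap.le_opNorm _ _).trans ?_
      gcongr; exact (f1 x).trans (hle1 B hB0)
    · refine (ContinuousLinearMap.le_opNorm _ _).trans ?_
      gcongr
      refine (ContinuousLinearMap.opNorm_comp_le _ _).trans ?_
      exact ((by gcongr; exact f2 x : _ ≤ τ * B).trans (hle2 B hB0))
  · rw [(hQ x).fderiv, (hQ y).fderiv]
    apply ContinuousLinearMap.opNorm_le_bound _ (by positivity)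
    intro h
    have e : (((fderiv ℝ f x).prod ((trL d).comp (fderiv ℝ (fderiv ℝ f) x))) - 
      ((fderiv ℝ f y).prod ((trL d).comp (fderiv ℝ (fderiv ℝ f) y)))) h =
        ((fderiv ℝ f x - fderiv ℝ f y) h, (trL d).comp (fderiv ℝ (fderiv ℝ f) x - fderiv ℝ (fderiv ℝ f) y) h) := by
      simp
    rw [e, Prod.norm_mk, mul_assoc _ B]
    apply max_le
    · refine (ContinuousLinearMap.le_opNorm _ _).trans ?_
      gcongr; exact (l1 x y).trans (hle1 _ (by positivity))
    · refine (ContinuousLinearMap.le_opNorm _ _).trans ?_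
      gcongr
      refine (ContinuousLinearMap.opNorm_comp_le _ _).trans ?_
      exact ((by gcongr; exact l2 x y : _ ≤ τ * (B * ‖x - y‖)).trans (hle2 _ (by positivity)))

def TT {d : ℕ} {V : Type*} [AddCommGroup V] [Module ℝ V] (Ω : Set (Euc d)) (ι : V →ₗ[ℝ] (Euc d → Euc d)) (f : V) :
    Euc d × ℝ → Euc d × ℝ := fun p => QQ (indicator Ω (ι f)) p.1

theorem TT_nice {d : ℕ} {V : Type*} [NormedAddCommGroup V] [NormedSpace ℝ V] {Ω : Set (Euc d)} (hΩ : IsOpen Ω)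
    (hΩb : Bornology.IsBounded Ω) {ι : V →ₗ[ℝ] (Euc d → Euc d)} {c : ℝ} (hc : 0 < c)
    (hemb : ∀ f : V, MemC0k 3 Ω (ι f) ∧ CknormOn 3 Ω (ι f) ≤ c * ‖f‖) :
    Nice (TT Ω ι) ((1 + ‖trL d‖) * c) := by
  have hcd : ∀ f, ContDiff ℝ 3 (indicator Ω (ι f)) := fun f => (ext_bound hΩ hΩb (hemb f).1).1
  have hb : ∀ f, _ := fun f => QQ_bounds (B := c * ‖f‖) (hcd f) 
    (fun j hj x => ((ext_bound hΩ hΩb (hemb f).1).2 j hj x).trans (hemb f).2)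
  have hder : ∀ f p, HasFDerivAt (TT Ω ι f) ((fderiv ℝ (QQ (indicator Ω (ι f))) p.1).comp (ContinuousLinearMap.fst ℝ _ _)) p :=
    fun f p => ((hb f).1 p.1).hasFDerivAt.comp p hasFDerivAt_fst
  have hfst : ‖ContinuousLinearMap.fst ℝ (Euc d) ℝ‖ ≤ 1 := ContinuousLinearMap.norm_fst_le ..
  refine ⟨by positivity, ?_, fun f p => (hder f p).differentiableAt, ?_, ?_, ?_⟩
  · intro f g a z
    have e : indicator Ω (ι (f + a • g)) = indicator Ω (ι f) + a • indicator Ω (ι g) := by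
      ext1 x
      by_cases hx : x ∈ Ω <;> simp [hx]
    have d1 := ((hcd f).differentiable (by norm_num)) z.1
    have d2 := ((hcd g).differentiable (by norm_num)) z.1
    simp only [TT, QQ, e, divg_eq]
    rw [fderiv_add d1 (d2.const_smul a), fderiv_const_smul d2]
    simp
  · intro f z
    rw [mul_assoc]
    exact (hb f).2.1 z.1
  · intro f z
    rw [mul_assoc, (hder f z).fderiv]
    refine (ContinuousLinearMap.opNorm_comp_le _ _).trans ?_
    exact (mul_le_of_le_one_right (norm_nonneg _) hfst).trans ((hb f).2.2.1 z.1)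
  · intro f z w
    rw [mul_assoc _ c, (hder f z).fderiv, (hder f w).fderiv, ← ContinuousLinearMap.sub_comp]
    refine (ContinuousLinearMap.opNorm_comp_le _ _).trans ?_
    refine (mul_le_of_le_one_right (norm_nonneg _) hfst).trans (((hb f).2.2.2 z.1 w.1).trans ?_)
    gcongr
    exact norm_fst_le (z - w)
end

section

theorem gronwall_back {F : Type*} [NormedAddCommGroup F] [NormedSpace ℝ F] [CompleteSpace F] {y h : ℝ → F} {m : ℝ → ℝ} {a b : ℝ} (hab : a ≤ b)
    (hy : IsPrim y h a b) (hm : IntervalIntegrable m volume a b) (hm0 : ∀ t, 0 ≤ m t)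
    (hb : ∀ r ∈ Ico a b, ‖h r‖ ≤ m r * ‖y r - y b‖) : y a = y b := by
  have hyc := hy.cont hab
  have hmap : MapsTo (fun t => a + b - t) (Icc a b) (Icc a b) := by
    intro t ht; constructor <;> linarith [ht.1, ht.2]
  have hφc : ContinuousOn (fun τ => ‖y (a + b - τ) - y b‖) (Icc a b) := by
    apply ContinuousOn.norm
    apply ContinuousOn.sub _ continuousOn_const
    exact hyc.comp (by fun_prop) hmap
  have hm' : IntervalIntegrable (fun t => m (a + b - t)) volume a b := by
    have := (hm.comp_sub_left (a + b)).symm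
    simpa using this
  have key := gronwall_int (φ := fun τ => ‖y (a + b - τ) - y b‖) (m := fun t => m (a + b - t)) (C := 0) hφc hm' (fun t => hm0 _) ?_ b ⟨hab, le_rfl⟩
  · simp only [zero_mul, add_sub_cancel_right, norm_le_zero_iff] at key
    exact sub_eq_zero.1 key
  · intro t ht
    rw [zero_add]
    have hbm : b ∈ Icc a b := ⟨hab, le_rfl⟩
    have h1 := hy.sub (hmap ht) hbm
    have e := intervalIntegral.integral_comp_sub_left (fun σ => m σ * ‖y σ - y b‖) (a + b) (a := a) (b := t)
    simp only [add_sub_cancel_left] at e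
    rw [e]
    have : y (a + b - t) - y b = - ∫ r in (a + b - t)..b, h r := by rw [h1]; abel
    rw [this, norm_neg]
    have hle : a + b - t ≤ b := by linarith [ht.1]
    apply intervalIntegral.norm_integral_le_of_norm_le hle
    · filter_upwards [ae_ne b] with r hr hr'
      exact hb r ⟨(hmap ht).1.trans hr'.1.le, lt_of_le_of_ne hr'.2 hr⟩
    · apply IntervalIntegrable.mul_continuousOn
      · apply hm.mono_set
        rw [uIcc_of_le hle, uIcc_of_le hab]; exact Icc_subset_Icc_left (hmap ht).1
      · rw [uIcc_of_le hle]
        exact ((hyc.sub continuousOn_const).norm).mono (Icc_subset_Icc_left (hmap ht).1)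

theorem flow_in {d : ℕ} {V : Type*} [NormedAddCommGroup V] [NormedSpace ℝ V] {Ω : Set (Euc d)} (hΩ : IsOpen Ω)
    {ι : V →ₗ[ℝ] (Euc d → Euc d)} {C : ℝ} (hN : Nice (TT Ω ι) C) {w : ℝ → V} (hw : StronglyMeasurable w)
    {s : ℝ} (hs : s ≤ 1) (hwi : IntervalIntegrable (fun t => ‖w t‖) volume s 1) {x : Euc d} (hx : x ∈ Ω)
    {y : ℝ → Euc d} (hy : ∀ t ∈ Icc s 1, y t = x + ∫ u in s..t, ι (w u) (y u)) :
    (∀ t ∈ Icc s 1, y t ∈ Ω) ∧ IsPrim y (fun r => indicator Ω (ι (w r)) (y r)) s 1 := by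
  set h : ℝ → Euc d := fun r => ι (w r) (y r) with hh
  let m : ℝ → ℝ := fun r => C * ‖w r‖
  have hm0 : ∀ r, 0 ≤ m r := fun r => mul_nonneg hN.C0 (norm_nonneg _)
  have hmi : IntervalIntegrable m volume s 1 := hwi.const_mul C
  have hys : y s = x := by simpa using hy s ⟨le_rfl, hs⟩
  have hb0 : ∀ r z, ‖indicator Ω (ι (w r)) z‖ ≤ m r := fun r z => 
    (norm_fst_le _).trans (hN.b0 (w r) (z, 0))
  have hb1 : ∀ r z q, q ∉ Ω → ‖indicator Ω (ι (w r)) z‖ ≤ m r * ‖z - q‖ := by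
    intro r z q hq
    have h1 := (norm_fst_le _).trans (hN.lip (w r) (q, 0) (z, 0))
    simpa [TT, QQ, hq] using h1
  have hprim : ∀ t ∈ Icc s 1, IntervalIntegrable h volume s t → IsPrim y h s t := by
    intro t ht hi
    exact ⟨hi, fun r hr => by rw [hys]; exact hy r ⟨hr.1, hr.2.trans ht.2⟩⟩
  let S : Set ℝ := {t | t ∈ Icc s 1 ∧ IntervalIntegrable h volume s t ∧ ∀ r ∈ Icc s t, y r ∈ Ω}
  have hsS : s ∈ S := ⟨⟨le_rfl, hs⟩, by simp, fun r hr => by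
    have : r = s := le_antisymm hr.2 hr.1
    rw [this, hys]; exact hx⟩
  have hbdd : BddAbove S := ⟨1, fun t ht => ht.1.2⟩
  set T := sSup S with hT
  have hsT : s ≤ T := le_csSup hbdd hsS
  have hT1 : T ≤ 1 := csSup_le ⟨s, hsS⟩ (fun t ht => ht.1.2)
  have hTm : T ∈ Icc s 1 := ⟨hsT, hT1⟩
  have hlow : ∀ t ∈ Ico s T, t ∈ S := by
    intro t ht
    obtain ⟨t', ht', htt'⟩ := exists_lt_of_lt_csSup ⟨s, hsS⟩ ht.2
    refine ⟨⟨ht.1, ht.2.le.trans hT1⟩, ?_, fun r hr => ht'.2.2 r ⟨hr.1, hr.2.trans htt'.le⟩⟩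
    apply ht'.2.1.mono_set
    rw [uIcc_of_le ht.1, uIcc_of_le ht'.1.1]
    exact Icc_subset_Icc_right htt'.le
  have hyin : ∀ t ∈ Ico s T, y t ∈ Ω := fun t ht => (hlow t ht).2.2 t ⟨ht.1, le_rfl⟩
  have hyco : ContinuousOn y (Ico s T) := by
    intro t ht
    obtain ⟨t', h1, h2⟩ := exists_between ht.2
    have hc := (hprim t' (hlow t' ⟨ht.1.trans h1.le, h2⟩).1 (hlow t' ⟨ht.1.trans h1.le, h2⟩).2.1).cont (ht.1.trans h1.le)
    apply (hc t ⟨ht.1, h1.le⟩).mono_of_mem_nhdsWithin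
    rw [mem_nhdsWithin]
    exact ⟨Iio t', isOpen_Iio, h1, fun r hr => ⟨hr.2.1, hr.1.le⟩⟩
  -- step A
  have hiT : IntervalIntegrable h volume s T := by
    have hmT : IntervalIntegrable m volume s T := hmi.mono_set (by
      rw [uIcc_of_le hsT, uIcc_of_le hs]; exact Icc_subset_Icc_right hT1)
    rw [intervalIntegrable_iff_integrableOn_Ico_of_le hsT] at hmT ⊢
    apply Integrable.mono' hmT
    · have h1 : AEStronglyMeasurable (fun r => TT Ω ι (w r) (y r, 0)) (volume.restrict (Ico s T)) :=
        hN.cont0.comp_aestronglyMeasurable (hw.aestronglyMeasurable.prodMk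
          ((hyco.aestronglyMeasurable measurableSet_Ico).prodMk aestronglyMeasurable_const))
      apply h1.fst.congr
      filter_upwards [ae_restrict_mem measurableSet_Ico] with r hr
      simp [TT, QQ, hh, hyin r hr]
    · filter_upwards [ae_restrict_mem measurableSet_Ico] with r hr
      have := hb0 r (y r)
      simpa [hh, hyin r hr] using this
  have hpT := hprim T hTm hiT
  -- step B
  have hyT : y T ∈ Ω := by
    by_contra hq
    have := gronwall_back hsT hpT (m := m) (hmi.mono_set (by
      rw [uIcc_of_le hsT, uIcc_of_le hs]; exact Icc_subset_Icc_right hT1)) hm0 (fun r hr => by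
        have := hb1 r (y r) (y T) hq
        simpa [hh, hyin r hr] using this)
    rw [← this, hys] at hq
    exact hq hx
  have hyinc : ∀ t ∈ Icc s T, y t ∈ Ω := by
    intro t ht
    rcases eq_or_lt_of_le ht.2 with h1 | h1
    · rw [h1]; exact hyT
    · exact hyin t ⟨ht.1, h1⟩
  -- step C
  have hT1' : T = 1 := by
    by_contra hne
    have hlt : T < 1 := lt_of_le_of_ne hT1 hne
    by_cases hex : ∃ t, T < t ∧ t ≤ 1 ∧ IntervalIntegrable h volume s t
    · obtain ⟨t, h1, h2, h3⟩ := hex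
      have hst : s ≤ t := hsT.trans h1.le
      have hc := (hprim t ⟨hst, h2⟩ h3).cont hst
      have h4 : y ⁻¹' Ω ∈ 𝓝[Icc s t] T := (hc T ⟨hsT, h1.le⟩) (hΩ.mem_nhds hyT)
      have h5 : 𝓝[Icc T t] T ≤ 𝓝[Icc s t] T := nhdsWithin_mono _ (Icc_subset_Icc_left hsT)
      have h6 := h5 h4
      rw [nhdsWithin_Icc_eq_nhdsGE h1, mem_nhdsGE_iff_exists_Icc_subset] at h6
      obtain ⟨u, hu, hu2⟩ := h6
      have hu : T < u := hu
      have hmem : min u t ∈ S := by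
        refine ⟨⟨hsT.trans (le_min hu.le h1.le), (min_le_right _ _).trans h2⟩, ?_, ?_⟩
        · apply h3.mono_set
          rw [uIcc_of_le (hsT.trans (le_min hu.le h1.le)), uIcc_of_le hst]
          exact Icc_subset_Icc_right (min_le_right _ _)
        · intro r hr
          by_cases hrT : r ≤ T
          · exact hyinc r ⟨hr.1, hrT⟩
          · exact hu2 ⟨(not_le.1 hrT).le, hr.2.trans (min_le_left _ _)⟩
      have := le_csSup hbdd hmem
      exact absurd this (not_le.2 (lt_min hu h1))
    · push Not at hex
      have hyx : ∀ t ∈ Ioc T 1, y t = x := by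
        intro t ht
        rw [hy t ⟨hsT.trans ht.1.le, ht.2⟩, intervalIntegral.integral_undef (hex t ht.1 ht.2), add_zero]
      apply hex 1 hlt le_rfl
      apply hiT.trans
      have hwT : IntervalIntegrable (fun t => ‖w t‖) volume T 1 := hwi.mono_set (by
        rw [uIcc_of_le hs, uIcc_of_le hT1]; exact Icc_subset_Icc_left hsT)
      have := hN.ii0 (z := fun _ => (x, 0)) hT1 hw hwT continuousOn_const
      have h2 : IntervalIntegrable (fun r => (TT Ω ι (w r) (x, 0)).1) volume T 1 := ⟨this.1.fst, this.2.fst⟩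
      apply h2.congr
      intro r hr
      rw [uIoc_of_le hT1] at hr
      simp [TT, QQ, hh, hyx r hr, hx]
  rw [hT1'] at hpT hyinc
  exact ⟨hyinc, hpT.congr' hs (fun t ht => by simp [hh, hyinc t ht])⟩
end

section

theorem contDiff_det {d : ℕ} : ContDiff ℝ 1 (fun A : Euc d →L[ℝ] Euc d => A.det) := by
  let b := (EuclideanSpace.basisFun (Fin d) ℝ).toBasis
  have : (fun A : Euc d →L[ℝ] Euc d => A.det) = fun A => (Matrix.of (fun i j => (A (b j)) i)).det := by
    ext A
    rw [ContinuousLinearMap.det, ← LinearMap.det_toMatrix b]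
    congr 1
    ext i j
    simp [LinearMap.toMatrix_apply, b]
  rw [this]
  simp only [Matrix.det_apply]
  apply ContDiff.sum
  intro σ _
  apply ContDiff.const_smul
  apply contDiff_prod
  intro i _
  simp only [Matrix.of_apply]
  have h1 : ContDiff ℝ 1 (fun A : Euc d →L[ℝ] Euc d => A (b i)) := (ContinuousLinearMap.apply ℝ (Euc d) (b i)).contDiff
  exact (EuclideanSpace.proj (𝕜 := ℝ) (σ i)).contDiff.comp h1

theorem det_one_add {d : ℕ} (A : Euc d →L[ℝ] Euc d) : HasDerivAt (fun τ : ℝ => (1 + τ • A : Euc d →L[ℝ] Euc d).det) (trL d A) 0 := by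
  let b := (EuclideanSpace.basisFun (Fin d) ℝ).toBasis
  have h1 : ∀ τ : ℝ, (1 + τ • A : Euc d →L[ℝ] Euc d).det = (1 + τ • LinearMap.toMatrix b b (A : Euc d →ₗ[ℝ] Euc d)).det := by
    intro τ
    rw [ContinuousLinearMap.det, ← LinearMap.det_toMatrix b]
    congr 1
    have : ((1 + τ • A : Euc d →L[ℝ] Euc d) : Euc d →ₗ[ℝ] Euc d) = 1 + τ • (A : Euc d →ₗ[ℝ] Euc d) := rfl
    rw [this, map_add, map_smul, LinearMap.toMatrix_one]
  simp only [h1]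
  have h2 : trL d A = (LinearMap.toMatrix b b (A : Euc d →ₗ[ℝ] Euc d)).trace := by
    rw [trL_apply, LinearMap.trace_eq_matrix_trace ℝ b]
  rw [h2]
  set B := LinearMap.toMatrix b b (A : Euc d →ₗ[ℝ] Euc d)
  have hp : ∀ τ : ℝ, (1 + τ • B).det = 1 + B.trace * τ + ((1 + (Polynomial.X : Polynomial ℝ) • B.map Polynomial.C).det).divX.divX.eval τ * τ ^ 2 := fun τ => Matrix.det_one_add_smul τ B
  rw [show (fun τ : ℝ => (1 + τ • B).det) = _ from funext hp]
  set p := ((1 + (Polynomial.X : Polynomial ℝ) • B.map Polynomial.C).det).divX.divX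
  have h3 := ((hasDerivAt_const (0:ℝ) (1:ℝ)).add ((hasDerivAt_id (0:ℝ)).const_mul B.trace)).add ((p.hasDerivAt 0).mul ((hasDerivAt_id (0:ℝ)).pow 2))
  refine h3.congr_deriv ?_
  simp

theorem fderiv_det {d : ℕ} (A Y : Euc d →L[ℝ] Euc d) :
    fderiv ℝ (fun A : Euc d →L[ℝ] Euc d => A.det) Y (A * Y) = trL d A * Y.det := by
  have h1 : HasFDerivAt (fun A : Euc d →L[ℝ] Euc d => A.det) _ Y := (contDiff_det.differentiable one_ne_zero Y).hasFDerivAt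
  have h2 : HasDerivAt (fun τ : ℝ => Y + τ • (A * Y)) (A * Y) 0 := by
    have := ((hasDerivAt_id (0:ℝ)).smul_const (A * Y)).const_add Y
    rw [one_smul] at this; exact this
  have h3 : HasDerivAt (fun τ : ℝ => (Y + τ • (A * Y)).det) (fderiv ℝ (fun A : Euc d →L[ℝ] Euc d => A.det) Y (A * Y)) 0 := by
    have h1' : HasFDerivAt (fun A : Euc d →L[ℝ] Euc d => A.det) (fderiv ℝ (fun A : Euc d →L[ℝ] Euc d => A.det) Y) (Y + (0:ℝ) • (A * Y)) := by
      have e : Y + (0:ℝ) • (A * Y) = Y := by ext1 z; simp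
      rw [e]; exact h1
    exact h1'.comp_hasDerivAt (0:ℝ) h2
  have h4 := (det_one_add A).mul_const Y.det
  have h5 : (fun τ : ℝ => (1 + τ • A : Euc d →L[ℝ] Euc d).det * Y.det) = fun τ : ℝ => (Y + τ • (A * Y)).det := by
    ext τ
    have : Y + τ • (A * Y) = (1 + τ • A) * Y := by ext1 z; simp
    rw [this, ContinuousLinearMap.det, ContinuousLinearMap.det, ContinuousLinearMap.det, ← LinearMap.det_comp]
    rfl
  rw [h5] at h4
  exact h3.unique h4

theorem liouville {d : ℕ} {A Y : ℝ → Euc d →L[ℝ] Euc d} {a b : ℝ} (hab : a ≤ b)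
    (hA : IntervalIntegrable (fun r => trL d (A r)) volume a b)
    (hY : IsPrim Y (fun r => A r * Y r) a b) (hYa : Y a = 1) : (Y b).det = Real.exp (∫ r in a..b, trL d (A r)) := by
  have h1 := hY.comp hab contDiff_det
  have h2 : IsPrim (fun t => ∫ r in a..t, trL d (A r)) (fun r => trL d (A r)) a b := ⟨hA, fun t ht => by simp⟩
  have h3 := h2.comp hab (g := fun x : ℝ => Real.exp (-x)) (by fun_prop)
  have h4 := (h1.bilin h3 hab (ContinuousLinearMap.mul ℝ ℝ)).2 b ⟨hab, le_rfl⟩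
  have hd : ∀ x q : ℝ, fderiv ℝ (fun x : ℝ => Real.exp (-x)) x q = - Real.exp (-x) * q := by
    intro x q
    have : HasDerivAt (fun x : ℝ => Real.exp (-x)) (Real.exp (-x) * (-1)) x := ((hasDerivAt_id x).neg).exp
    rw [this.hasFDerivAt.fderiv]; simp; ring
  have h5 : ∀ t, (Y t).det * (- Real.exp (-∫ r in a..t, trL d (A r)) * trL d (A t)) + trL d (A t) * (Y t).det * Real.exp (-∫ r in a..t, trL d (A r)) = 0 := by
    intro t; ring
  simp only [fderiv_det, hd, ContinuousLinearMap.mul_apply', h5, intervalIntegral.integral_same, hYa, intervalIntegral.integral_zero] at h4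
  have h6 : (1 : Euc d →L[ℝ] Euc d).det = 1 := by
    simp [ContinuousLinearMap.det]
  rw [h6] at h4
  rw [Real.exp_neg] at h4
  field_simp at h4
  simpa [mul_comm] using h4
end

section

section
variable {d : ℕ} {V : Type*} [NormedAddCommGroup V] [NormedSpace ℝ V]

def Good (w : ℝ → V) : Prop := StronglyMeasurable w ∧ IntegrableOn (fun t => ‖w t‖ ^ 2) (Icc (0:ℝ) 1)

theorem Good.memLp {w : ℝ → V} (h : Good w) : MemLp w 2 (volume.restrict (Icc (0:ℝ) 1)) := by
  rw [memLp_two_iff_integrable_sq_norm h.1.aestronglyMeasurable]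
  exact h.2

theorem good_of_memLp {w : ℝ → V} (h1 : StronglyMeasurable w) (h : MemLp w 2 (volume.restrict (Icc (0:ℝ) 1))) : Good w :=
  ⟨h1, (memLp_two_iff_integrable_sq_norm h.1).1 h⟩

theorem Good.add_smul {w u : ℝ → V} (h : Good w) (hu : Good u) (ε : ℝ) : Good (fun t => w t + ε • u t) :=
  good_of_memLp (h.1.add (hu.1.const_smul ε)) (h.memLp.add (hu.memLp.const_smul ε))

theorem Good.ii {w : ℝ → V} (h : Good w) {a b : ℝ} (ha : a ∈ Icc (0:ℝ) 1) (hb : b ∈ Icc (0:ℝ) 1) :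
    IntervalIntegrable (fun t => ‖w t‖) volume a b := by
  have h1 : IntegrableOn w (Icc (0:ℝ) 1) := h.memLp.integrable (by norm_num)
  have h2 : IntervalIntegrable (fun t => ‖w t‖) volume 0 1 := by
    rw [intervalIntegrable_iff_integrableOn_Icc_of_le zero_le_one]; exact h1.norm
  apply h2.mono_set
  rw [uIcc_of_le (zero_le_one (α := ℝ))]
  exact ordConnected_Icc.uIcc_subset ha hb

structure Setup (Ω : Set (Euc d)) (ι : V →ₗ[ℝ] (Euc d → Euc d)) (Φ : (ℝ → V) → ℝ → ℝ → Euc d → Euc d) (C : ℝ) : Prop where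
  hΩ : IsOpen Ω
  hN : Nice (TT Ω ι) C
  hQ : ∀ f, Differentiable ℝ (QQ (indicator Ω (ι f)))
  flow : ∀ w : ℝ → V, Good w → ∀ s ∈ Icc (0:ℝ) 1, ∀ t ∈ Icc (0:ℝ) 1, ∀ x ∈ Ω,
      Φ w s t x = x + ∫ u in s..t, ι (w u) (Φ w s u x)

variable {Ω : Set (Euc d)} {ι : V →ₗ[ℝ] (Euc d → Euc d)} {Φ : (ℝ → V) → ℝ → ℝ → Euc d → Euc d} {C : ℝ}

theorem Setup.fderivTT (S : Setup Ω ι Φ C) (f : V) (p : Euc d × ℝ) :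
    fderiv ℝ (TT Ω ι f) p = (fderiv ℝ (QQ (indicator Ω (ι f))) p.1).comp (ContinuousLinearMap.fst ℝ _ _) := by
  have : HasFDerivAt (TT Ω ι f) ((fderiv ℝ (QQ (indicator Ω (ι f))) p.1).comp (ContinuousLinearMap.fst ℝ _ _)) p :=
    (S.hQ f p.1).hasFDerivAt.comp p hasFDerivAt_fst
  exact this.fderiv

theorem Setup.prim (S : Setup Ω ι Φ C) {w : ℝ → V} (hw : Good w) {s : ℝ} (hs : s ∈ Icc (0:ℝ) 1) {x : Euc d} (hx : x ∈ Ω) :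
    (∀ t ∈ Icc s 1, Φ w s t x ∈ Ω) ∧ IsPrim (fun t => Φ w s t x) (fun r => indicator Ω (ι (w r)) (Φ w s r x)) s 1 :=
  flow_in S.hΩ S.hN hw.1 hs.2 (hw.ii hs ⟨zero_le_one, le_rfl⟩) hx (fun t ht => S.flow w hw s hs t ⟨hs.1.trans ht.1, ht.2⟩ x hx)

theorem Setup.start (S : Setup Ω ι Φ C) {w : ℝ → V} (hw : Good w) {s : ℝ} (hs : s ∈ Icc (0:ℝ) 1) {x : Euc d} (hx : x ∈ Ω) :
    Φ w s s x = x := by simpa using S.flow w hw s hs s hs x hx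

def ell (Ω : Set (Euc d)) (ι : V →ₗ[ℝ] (Euc d → Euc d)) (w : ℝ → V) (y : ℝ → Euc d) (s t : ℝ) : ℝ :=
  ∫ r in s..t, divg (indicator Ω (ι (w r))) (y r)

theorem Setup.lift (S : Setup Ω ι Φ C) {w : ℝ → V} (hw : Good w) {a : ℝ} (ha : a ∈ Icc (0:ℝ) 1) {y : ℝ → Euc d}
    (hy : IsPrim y (fun r => indicator Ω (ι (w r)) (y r)) a 1) :
    IsPrim (fun t => (y t, ell Ω ι w y a t)) (fun r => TT Ω ι (w r) (y r, ell Ω ι w y a r)) a 1 := by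
  have hyc := hy.cont ha.2
  have h1 := S.hN.ii0 (z := fun r => (y r, 0)) ha.2 hw.1 (hw.ii ha ⟨zero_le_one, le_rfl⟩) (hyc.prodMk continuousOn_const)
  have h2 : IntervalIntegrable (fun r => divg (indicator Ω (ι (w r))) (y r)) volume a 1 := ⟨h1.1.snd, h1.2.snd⟩
  have h3 : IsPrim (fun t => ell Ω ι w y a t) (fun r => divg (indicator Ω (ι (w r))) (y r)) a 1 :=
    ⟨h2, fun t ht => by simp [ell]⟩
  exact hy.prod h3

theorem Setup.fund (S : Setup Ω ι Φ C) {w : ℝ → V} (hw : Good w) {a : ℝ} (ha : a ∈ Icc (0:ℝ) 1) {y : ℝ → Euc d}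
    (hy : ContinuousOn y (Icc a 1)) :
    ∃ M N : ℝ → Euc d × ℝ →L[ℝ] Euc d × ℝ, M a = 1 ∧ N a = 1 ∧ IsPrim M (fun r => fderiv ℝ (TT Ω ι (w r)) (y r, 0) * M r) a 1 ∧
      IsPrim N (fun r => -(N r * fderiv ℝ (TT Ω ι (w r)) (y r, 0))) a 1 ∧ (∀ t ∈ Icc a 1, N t * M t = 1) ∧
      ∀ t ∈ Icc a 1, M t * N t = 1 :=
  fund_exists ha.2 (S.hN.ii1 (z := fun r => (y r, 0)) ha.2 hw.1 (hw.ii ha ⟨zero_le_one, le_rfl⟩) (hy.prodMk continuousOn_const))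

theorem hasFDerivAt_of_quad {E F : Type*} [NormedAddCommGroup E] [NormedSpace ℝ E] [NormedAddCommGroup F] [NormedSpace ℝ F]
    {f : E → F} {L : E →L[ℝ] F} {x : E} {K : ℝ} (h : ∀ᶠ y in 𝓝 x, ‖f y - f x - L (y - x)‖ ≤ K * ‖y - x‖ ^ 2) :
    HasFDerivAt f L x := by
  rw [hasFDerivAt_iff_isLittleO]
  have h1 : (fun y => f y - f x - L (y - x)) =O[𝓝 x] fun y => ‖y - x‖ ^ 2 := by
    apply Asymptotics.IsBigO.of_bound K
    filter_upwards [h] with y hy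
    simpa using hy
  apply h1.trans_isLittleO
  have h2 : (fun y => ‖y - x‖ ^ 2) =o[𝓝 x] fun y => ‖y - x‖ := by
    have h3 : Tendsto (fun y => ‖y - x‖) (𝓝 x) (𝓝 0) := by
      have : Continuous (fun y => ‖y - x‖) := by fun_prop
      simpa using this.tendsto x
    have := (Asymptotics.isLittleO_pow_pow (𝕜 := ℝ) (m := 1) (n := 2) (by norm_num)).comp_tendsto h3
    simpa [Function.comp_def] using this
  exact h2.of_norm_right

theorem Setup.hasFDeriv (S : Setup Ω ι Φ C) {w : ℝ → V} (hw : Good w) {a s : ℝ} (ha : 0 ≤ a) (hs : s ∈ Icc a 1) {y : ℝ → Euc d}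
    (hy : IsPrim y (fun r => indicator Ω (ι (w r)) (y r)) a 1) (hyΩ : y s ∈ Ω)
    {M N : ℝ → Euc d × ℝ →L[ℝ] Euc d × ℝ}
    (hM : IsPrim M (fun r => fderiv ℝ (TT Ω ι (w r)) (y r, 0) * M r) a 1) (hMN : ∀ t ∈ Icc a 1, M t * N t = 1) :
    HasFDerivAt (fun x => (Φ w s 1 x, ell Ω ι w (fun r => Φ w s r x) s 1)) ((M 1 * N s).comp (ContinuousLinearMap.inl ℝ _ _)) (y s) := by
  have hs0 : s ∈ Icc (0:ℝ) 1 := ⟨ha.trans hs.1, hs.2⟩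
  let m : ℝ → ℝ := fun r => C * ‖w r‖
  have hmi : IntervalIntegrable m volume s 1 := (hw.ii hs0 ⟨zero_le_one, le_rfl⟩).const_mul C
  have hZ := S.lift hw hs0 (hy.mono hs ⟨hs.1.trans hs.2, le_rfl⟩)
  have key : ∀ x ∈ Ω, ‖(Φ w s 1 x, ell Ω ι w (fun r => Φ w s r x) s 1) - (y 1, ell Ω ι w y s 1) - (M 1 * N s) (x - y s, 0)‖
      ≤ (Real.exp (∫ r in s..1, m r) ^ 2 * (∫ r in s..1, m r) * Real.exp (∫ r in s..1, m r)) * ‖x - y s‖ ^ 2 := by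
    intro x hx
    have hZ' := S.lift hw hs0 (S.prim hw hs0 hx).2
    have h1 := pert_space (F := fun r => TT Ω ι (w r)) (M := M) (N := N) hs.1 hs.2 (fun t => mul_nonneg S.hN.C0 (norm_nonneg _)) hmi (fun r => S.hN.diff _) (fun r => S.hN.b1 _)
      (fun r => S.hN.b2 _) hZ hZ' (by simpa only [S.fderivTT] using hM) (hMN s hs) rfl 1 ⟨hs.2, le_rfl⟩
    have e : ((Φ w s s x, ell Ω ι w (fun t => Φ w s t x) s s) - (y s, ell Ω ι w y s s) : Euc d × ℝ) = (x - y s, 0) := by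
      simp [S.start hw hs0 hx, ell]
    rw [e] at h1
    refine h1.trans (le_of_eq ?_)
    have hn : ‖((x - y s, 0) : Euc d × ℝ)‖ = ‖x - y s‖ := by simp [Prod.norm_mk]
    rw [hn]
  have h0 := key (y s) hyΩ
  simp only [sub_self, Prod.mk_zero_zero, map_zero, sub_zero, norm_zero, ne_eq, OfNat.ofNat_ne_zero, not_false_eq_true, zero_pow, mul_zero, norm_le_zero_iff] at h0
  apply hasFDerivAt_of_quad
  filter_upwards [S.hΩ.mem_nhds hyΩ] with x hx
  have := key x hx
  rw [← sub_eq_zero.1 h0] at this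
  exact this

theorem Setup.logdet (S : Setup Ω ι Φ C) {w : ℝ → V} (hw : Good w) {s : ℝ} (hs : s ∈ Icc (0:ℝ) 1) {x : Euc d} (hx : x ∈ Ω) :
    Real.log (fderiv ℝ (Φ w s 1) x).det = ell Ω ι w (fun r => Φ w s r x) s 1 := by
  have hp := (S.prim hw hs hx).2
  have hc := hp.cont hs.2
  obtain ⟨M, N, hM1, hN1, hM, hN, hNM, hMN⟩ := S.fund hw hs hc
  have hd := S.hasFDeriv hw (a := s) (s := s) hs.1 ⟨le_rfl, hs.2⟩ hp (by rw [S.start hw hs hx]; exact hx) hM hMN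
  have hst := S.start hw hs hx
  rw [hst] at hd
  have hd1 := hd.fst.fderiv
  simp only at hd1
  rw [hd1]
  have hY : IsPrim (fun r => (ContinuousLinearMap.fst ℝ _ _).comp ((M r * N s).comp (ContinuousLinearMap.inl ℝ (Euc d) ℝ)))
      (fun r => fderiv ℝ (indicator Ω (ι (w r))) (Φ w s r x) * (ContinuousLinearMap.fst ℝ _ _).comp ((M r * N s).comp (ContinuousLinearMap.inl ℝ (Euc d) ℝ))) s 1 := by
    let L : (Euc d × ℝ →L[ℝ] Euc d × ℝ) →L[ℝ] (Euc d →L[ℝ] Euc d) := 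
      LinearMap.toContinuousLinearMap
      { toFun := fun P => (ContinuousLinearMap.fst ℝ _ _).comp (P.comp (ContinuousLinearMap.inl ℝ (Euc d) ℝ))
        map_add' := by intros; ext; simp
        map_smul' := by intros; ext; simp }
    have := hM.clm L
    rw [hN1]
    simp only [mul_one]
    suffices he : (fun r => fderiv ℝ (indicator Ω (ι (w r))) (Φ w s r x) * (ContinuousLinearMap.fst ℝ _ _).comp ((M r).comp (ContinuousLinearMap.inl ℝ (Euc d) ℝ))) =
        fun r => L (fderiv ℝ (TT Ω ι (w r)) (Φ w s r x, 0) * M r) by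
      rw [he]; exact this
    funext r
    ext1 h
    have hQ1 : fderiv ℝ (indicator Ω (ι (w r))) (Φ w s r x) = (ContinuousLinearMap.fst ℝ _ _).comp (fderiv ℝ (QQ (indicator Ω (ι (w r)))) (Φ w s r x)) := 
      (S.hQ (w r) (Φ w s r x)).hasFDerivAt.fst.fderiv
    rw [hQ1]
    simp [L, S.fderivTT]
  have htr : ∀ r, trL d (fderiv ℝ (indicator Ω (ι (w r))) (Φ w s r x)) = divg (indicator Ω (ι (w r))) (Φ w s r x) := fun r => rfl
  have h1 := S.hN.ii0 (z := fun r => (Φ w s r x, 0)) hs.2 hw.1 (hw.ii hs ⟨zero_le_one, le_rfl⟩) (hc.prodMk continuousOn_const)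
  have h2 : IntervalIntegrable (fun r => divg (indicator Ω (ι (w r))) (Φ w s r x)) volume s 1 := ⟨h1.1.snd, h1.2.snd⟩
  have := liouville hs.2 h2 hY (by rw [hM1, hN1]; ext; simp)
  rw [this, Real.log_exp]
  rfl
end
end

section

section
variable {d : ℕ} {V : Type*} [NormedAddCommGroup V] [NormedSpace ℝ V]
variable {Ω : Set (Euc d)} {ι : V →ₗ[ℝ] (Euc d → Euc d)} {Φ : (ℝ → V) → ℝ → ℝ → Euc d → Euc d} {C : ℝ}

theorem ii_clm {G : Type*} [NormedAddCommGroup G] [NormedSpace ℝ G] {N : ℝ → G →L[ℝ] G} {f : ℝ → G} {a b : ℝ} (hab : a ≤ b)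
    (hNc : ContinuousOn N (Icc a b)) (hUi : IntervalIntegrable f volume a b) :
    IntervalIntegrable (fun s => N s (f s)) volume a b := by
  obtain ⟨C, hC⟩ := isCompact_Icc.exists_bound_of_continuousOn hNc
  rw [intervalIntegrable_iff_integrableOn_Ioc_of_le hab] at hUi ⊢
  apply Integrable.mono' (hUi.norm.const_mul C)
  · exact aesm_apply ((hNc.mono Ioc_subset_Icc_self).aestronglyMeasurable measurableSet_Ioc) hUi.1
  · filter_upwards [ae_restrict_mem measurableSet_Ioc] with t ht
    exact (ContinuousLinearMap.le_opNorm _ _).trans (by gcongr; exact hC t (Ioc_subset_Icc_self ht))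

theorem Setup.main (S : Setup Ω ι Φ C) {v : ℝ → V} (hv : Good v) {x : Euc d} (hx : x ∈ Ω) :
    ∃ P : ℝ → Euc d × ℝ →L[ℝ] Euc d × ℝ, ContinuousOn P (Icc 0 1) ∧ (∀ t ∈ Icc (0:ℝ) 1, ∀ b : ℝ, P t (0, b) = (0, b)) ∧
      (∀ t ∈ Icc (0:ℝ) 1, fderiv ℝ (Φ v t 1) (Φ v 0 t x) = (ContinuousLinearMap.fst ℝ _ _).comp ((P t).comp (ContinuousLinearMap.inl ℝ _ _))) ∧
      (∀ t ∈ Icc (0:ℝ) 1, ∀ h : Euc d, ⟪gradient (fun z => Real.log ((fderiv ℝ (Φ v t 1) z).det)) (Φ v 0 t x), h⟫ = (P t (h, 0)).2) ∧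
      ∀ u : ℝ → V, Good u → 
        IntervalIntegrable (fun s => P s (TT Ω ι (u s) (Φ v 0 s x, 0))) volume 0 1 ∧
        HasDerivAt (fun ε : ℝ => (Φ (fun t => v t + ε • u t) 0 1 x, Real.log ((fderiv ℝ (Φ (fun t => v t + ε • u t) 0 1) x).det)))
          (∫ s in (0:ℝ)..1, P s (TT Ω ι (u s) (Φ v 0 s x, 0))) 0 := by
  have h01 : (0:ℝ) ∈ Icc (0:ℝ) 1 := ⟨le_rfl, zero_le_one⟩
  have h11 : (1:ℝ) ∈ Icc (0:ℝ) 1 := ⟨zero_le_one, le_rfl⟩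
  obtain ⟨hyΩ, hy⟩ := S.prim hv h01 hx
  have hyc := hy.cont zero_le_one
  obtain ⟨M, N, hM0, hN0, hM, hN, hNM, hMN⟩ := S.fund hv h01 hyc
  have hNc := hN.cont zero_le_one
  have hNb : ∀ t ∈ Icc (0:ℝ) 1, ∀ b : ℝ, N t (0, b) = (0, b) := by
    intro t ht b
    let L : (Euc d × ℝ →L[ℝ] Euc d × ℝ) →L[ℝ] Euc d × ℝ := ContinuousLinearMap.apply ℝ _ (0, b)
    have h1 := (hN.clm L).2 t ht
    have h2 : ∀ r, L (-(N r * fderiv ℝ (TT Ω ι (v r)) (Φ v 0 r x, 0))) = 0 := by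
      intro r; simp [L, S.fderivTT]
    simp only [h2, hN0] at h1
    simpa [L] using h1
  have hPc : ContinuousOn (fun t => M 1 * N t) (Icc 0 1) := continuousOn_const.mul hNc
  have hder := fun t (ht : t ∈ Icc (0:ℝ) 1) => S.hasFDeriv hv le_rfl ht hy (hyΩ t ht) hM hMN
  refine ⟨fun t => M 1 * N t, hPc, ?_, ?_, ?_, ?_⟩
  · intro t ht b
    have h1 := hNb 1 h11 b
    have h2 := hNb t ht b
    have h3 := congrArg (fun A => A ((0, b) : Euc d × ℝ)) (hMN 1 h11)
    have h4 : M 1 (N 1 (0, b)) = (0, b) := h3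
    rw [h1] at h4
    change M 1 (N t (0, b)) = (0, b)
    rw [h2, h4]
  · intro t ht
    exact (hder t ht).fst.fderiv
  · intro t ht h
    have h1 : HasFDerivAt (fun z => Real.log ((fderiv ℝ (Φ v t 1) z).det)) ((ContinuousLinearMap.snd ℝ _ _).comp ((M 1 * N t).comp (ContinuousLinearMap.inl ℝ _ _))) (Φ v 0 t x) := by
      apply (hder t ht).snd.congr_of_eventuallyEq
      filter_upwards [S.hΩ.mem_nhds (hyΩ t ht)] with z hz
      exact S.logdet hv ht hz
    rw [gradient, h1.fderiv, InnerProductSpace.toDual_symm_apply]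
    rfl
  · intro u hu
    have hUi := S.hN.ii0 (z := fun r => (Φ v 0 r x, (0:ℝ))) zero_le_one hu.1 (hu.ii h01 h11) (hyc.prodMk continuousOn_const)
    refine ⟨ii_clm zero_le_one hPc hUi, ?_⟩
    have e1 : (∫ s in (0:ℝ)..1, (M 1 * N s) (TT Ω ι (u s) (Φ v 0 s x, 0))) = M 1 (∫ s in (0:ℝ)..1, N s (TT Ω ι (u s) (Φ v 0 s x, 0))) := by
      rw [← ContinuousLinearMap.intervalIntegral_comp_comm _ (ii_clm zero_le_one hNc hUi)]
      rfl
    rw [e1, hasDerivAt_iff_hasFDerivAt]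
    let m : ℝ → ℝ := fun r => C * (‖v r‖ + ‖u r‖)
    have hmi : IntervalIntegrable m volume 0 1 := ((hv.ii h01 h11).add (hu.ii h01 h11)).const_mul C
    have hC := S.hN.C0
    have mv : ∀ r, C * ‖v r‖ ≤ m r := fun r => by simp only [m]; gcongr; simp
    have mu : ∀ r, C * ‖u r‖ ≤ m r := fun r => by simp only [m]; gcongr; simp
    have hZ := S.lift hv h01 hy
    have key := fun ε : ℝ => pert_time (ε := ε) (F := fun r => TT Ω ι (v r)) (U := fun r => TT Ω ι (u r)) (m := m) (M := M) (N := N) zero_le_one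
      (fun t => by positivity) hmi (fun r => S.hN.diff _) (fun r z => (S.hN.b1 _ z).trans (mv r))
      (fun r z w => (S.hN.b2 _ z w).trans (by gcongr; exact mv r))
      (fun r z => (S.hN.b0 _ z).trans (mu r)) (fun r z w => (S.hN.lip _ z w).trans (by gcongr; exact mu r))
      hZ (by simpa only [S.hN.lin] using S.lift (hv.add_smul hu ε) h01 (S.prim (hv.add_smul hu ε) h01 hx).2)
      (by simp [S.start hv h01 hx, S.start (hv.add_smul hu ε) h01 hx, ell]) (by simpa only [S.fderivTT] using hM) hNc hMN hUi rfl
    apply hasFDerivAt_of_quad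
    refine Eventually.of_forall fun ε => ?_
    have h1 := key ε
    simp only [S.logdet (hv.add_smul hu _) h01 hx]
    have e0 : (fun t => v t + (0:ℝ) • u t) = v := by simp
    rw [e0]
    have e2 : ∀ s r, TT Ω ι (u s) (Φ v 0 s x, r) = TT Ω ι (u s) (Φ v 0 s x, 0) := fun s r => rfl
    simp only [e2 _ (ell _ _ _ _ _ _)] at h1
    simpa using h1
end
end

section

section
variable {d : ℕ} {V : Type*} [NormedAddCommGroup V] [InnerProductSpace ℝ V]

theorem good_iff [MeasurableSpace V] [BorelSpace V] (w : ℝ → V) : InV01 w ↔ Good w :=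
  ⟨fun h => ⟨stronglyMeasurable_of_real w h.1, h.2⟩, fun h => ⟨h.1.measurable, h.2⟩⟩

theorem Good.inner {g u : ℝ → V} (hg : Good g) (hu : Good u) : IntervalIntegrable (fun t => ⟪g t, u t⟫) volume 0 1 := by
  rw [intervalIntegrable_iff_integrableOn_Icc_of_le zero_le_one]
  apply Integrable.mono' (hg.2.add hu.2)
  · exact (hg.1.inner hu.1).aestronglyMeasurable
  · refine Eventually.of_forall fun t => ?_
    have h1 := norm_inner_le_norm (𝕜 := ℝ) (g t) (u t)
    simp only [Pi.add_apply]
    nlinarith [sq_nonneg (‖g t‖ - ‖u t‖), norm_nonneg (g t), norm_nonneg (u t)]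

theorem Good.sq {u : ℝ → V} (hu : Good u) : IntervalIntegrable (fun t => ‖u t‖ ^ 2) volume 0 1 := by
  rw [intervalIntegrable_iff_integrableOn_Icc_of_le zero_le_one]; exact hu.2

theorem Good.smul {u : ℝ → V} (hu : Good u) (a : ℝ) : Good (fun t => a • u t) :=
  good_of_memLp (hu.1.const_smul a) (hu.memLp.const_smul a)

theorem good_of_cont {D : ℝ → V} (h : Continuous D) : Good D :=
  ⟨h.stronglyMeasurable, (by fun_prop : Continuous fun t => ‖D t‖ ^ 2).continuousOn.integrableOn_Icc⟩

theorem sup_lemma [MeasurableSpace V] [BorelSpace V] {g g' : ℝ → V} (hg : Good g') (hgg : ∀ t ∈ Icc (0:ℝ) 1, g t = g' t) (J : (ℝ → V) → ℝ)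
    (hJ : ∀ u, Good u → J u = -∫ t in (0:ℝ)..1, ⟪g t, u t⟫) :
    Real.sqrt (∫ t in (0:ℝ)..1, ‖g t‖ ^ 2) = ⨆ u : {u : ℝ → V // InV01 u ∧ normV01 u = 1}, J u.1 := by
  have e1 : (∫ t in (0:ℝ)..1, ‖g t‖ ^ 2) = ∫ t in (0:ℝ)..1, ‖g' t‖ ^ 2 := by
    apply intervalIntegral.integral_congr
    intro t ht
    rw [uIcc_of_le zero_le_one] at ht
    simp only [hgg t ht]
  have e2 : ∀ u, Good u → J u = -∫ t in (0:ℝ)..1, ⟪g' t, u t⟫ := by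
    intro u hu
    rw [hJ u hu]
    congr 1
    apply intervalIntegral.integral_congr
    intro t ht
    rw [uIcc_of_le zero_le_one] at ht
    simp only [hgg t ht]
  rw [e1]
  set A := ∫ t in (0:ℝ)..1, ‖g' t‖ ^ 2 with hA
  have hA0 : 0 ≤ A := intervalIntegral.integral_nonneg zero_le_one (fun t _ => by positivity)
  have hu1 : ∀ u : {u : ℝ → V // InV01 u ∧ normV01 u = 1}, Good u.1 ∧ (∫ t in (0:ℝ)..1, ‖u.1 t‖ ^ 2) = 1 := by
    rintro ⟨u, h1, h2⟩
    refine ⟨(good_iff u).1 h1, ?_⟩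
    rwa [normV01, Real.sqrt_eq_one] at h2
  have hub : ∀ u : {u : ℝ → V // InV01 u ∧ normV01 u = 1}, J u.1 ≤ Real.sqrt A := by
    intro u
    obtain ⟨h1, h2⟩ := hu1 u
    rw [e2 _ h1]
    have key : ∀ a : ℝ, 0 ≤ a ^ 2 * A + 2 * a * (∫ t in (0:ℝ)..1, ⟪g' t, u.1 t⟫) + 1 := by
      intro a
      have : (∫ t in (0:ℝ)..1, ‖a • g' t + u.1 t‖ ^ 2) = a ^ 2 * A + 2 * a * (∫ t in (0:ℝ)..1, ⟪g' t, u.1 t⟫) + ∫ t in (0:ℝ)..1, ‖u.1 t‖ ^ 2 := by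
        rw [hA, ← intervalIntegral.integral_const_mul, ← intervalIntegral.integral_const_mul,
          ← intervalIntegral.integral_add (hg.sq.const_mul _) ((hg.inner h1).const_mul _),
          ← intervalIntegral.integral_add ((hg.sq.const_mul _).add ((hg.inner h1).const_mul _)) h1.sq]
        congr 1
        ext t
        rw [norm_add_sq_real, norm_smul, inner_smul_left, mul_pow]
        simp
        ring
      rw [h2] at this
      rw [← this]
      exact intervalIntegral.integral_nonneg zero_le_one (fun t _ => by positivity)
    apply Real.le_sqrt_of_sq_le
    have hd := discrim_le_zero (a := A) (b := 2 * ∫ t in (0:ℝ)..1, ⟪g' t, u.1 t⟫) (c := 1) (fun a => by nlinarith [key a])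
    rw [discrim] at hd
    nlinarith
  rcases hA0.eq_or_lt with h0 | hpos
  · have hz : ∀ u : {u : ℝ → V // InV01 u ∧ normV01 u = 1}, J u.1 = 0 := by
      intro u
      apply le_antisymm
      · have := hub u
        rwa [← h0, Real.sqrt_zero] at this
      · have hn : InV01 (fun t => (-1:ℝ) • u.1 t) ∧ normV01 (fun t => (-1:ℝ) • u.1 t) = 1 := by
          refine ⟨(good_iff _).2 ((hu1 u).1.smul _), ?_⟩
          simpa [normV01] using u.2.2
        have := hub ⟨_, hn⟩
        rw [← h0, Real.sqrt_zero, e2 _ ((hu1 u).1.smul _)] at this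
        rw [e2 _ (hu1 u).1]
        simpa [inner_neg_right] using this
    simp only [hz, ← h0]
    simp
  · apply le_antisymm
    · have hs := Real.sqrt_pos.2 hpos
      let u : ℝ → V := fun t => (-(Real.sqrt A)⁻¹) • g' t
      have hu : Good u := hg.smul _
      have hn : InV01 u ∧ normV01 u = 1 := by
        refine ⟨(good_iff _).2 hu, ?_⟩
        rw [normV01, Real.sqrt_eq_one]
        simp only [u, norm_smul, mul_pow, intervalIntegral.integral_const_mul]
        rw [← hA]
        simp only [norm_neg, norm_inv, Real.norm_eq_abs, sq_abs, inv_pow, Real.sq_sqrt hA0]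
        field_simp
      refine le_ciSup_of_le ⟨Real.sqrt A, ?_⟩ ⟨u, hn⟩ ?_
      · rintro _ ⟨w, rfl⟩; exact hub w
      · simp only
        rw [e2 _ hu]
        simp only [u, inner_smul_right, intervalIntegral.integral_const_mul, real_inner_self_eq_norm_sq]
        rw [← hA]
        apply le_of_eq
        field_simp
        exact Real.sq_sqrt hA0
    · have : Nonempty {u : ℝ → V // InV01 u ∧ normV01 u = 1} := by
        have hs := Real.sqrt_pos.2 hpos
        refine ⟨⟨fun t => ((Real.sqrt A)⁻¹) • g' t, (good_iff _).2 (hg.smul _), ?_⟩⟩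
        rw [normV01, Real.sqrt_eq_one]
        simp only [norm_smul, mul_pow, intervalIntegral.integral_const_mul]
        rw [← hA]
        simp only [norm_inv, Real.norm_eq_abs, sq_abs, inv_pow, Real.sq_sqrt hA0]
        field_simp
      exact ciSup_le hub

variable {Ω : Set (Euc d)} {ι : V →ₗ[ℝ] (Euc d → Euc d)} {C : ℝ}

theorem repr_cont (hN : Nice (TT Ω ι) C) {s : Set ℝ} {A : ℝ → V} {z p : ℝ → Euc d} (hz : ContinuousOn z s) (hp : ContinuousOn p s)
    (hA : ∀ t ∈ s, ∀ u, ⟪A t, u⟫ = ⟪p t, (TT Ω ι u (z t, 0)).1⟫ + (TT Ω ι u (z t, 0)).2) : ContinuousOn A s := by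
  have key : ∀ t ∈ s, ∀ r ∈ s, ‖A t - A r‖ ≤ C * (‖p t - p r‖ + ‖p r‖ * ‖z t - z r‖ + ‖z t - z r‖) := by
    intro t ht r hr
    set w := A t - A r with hw
    have h1 : ‖w‖ ^ 2 = ⟪p t - p r, (TT Ω ι w (z t, 0)).1⟫ + ⟪p r, (TT Ω ι w (z t, 0) - TT Ω ι w (z r, 0)).1⟫ + 
        (TT Ω ι w (z t, 0) - TT Ω ι w (z r, 0)).2 := by
      rw [← real_inner_self_eq_norm_sq]
      nth_rewrite 1 [hw]
      rw [inner_sub_left, hA t ht, hA r hr]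
      simp only [Prod.fst_sub, Prod.snd_sub, inner_sub_left, inner_sub_right]
      ring
    have b1 := hN.b0 w (z t, 0)
    have b2 := hN.lip w (z r, 0) (z t, 0)
    have e : ‖((z t, 0) - (z r, 0) : Euc d × ℝ)‖ = ‖z t - z r‖ := by simp [Prod.norm_mk]
    rw [e] at b2
    have c1 := (real_inner_le_norm (p t - p r) (TT Ω ι w (z t, 0)).1).trans (mul_le_mul_of_nonneg_left ((norm_fst_le _).trans b1) (norm_nonneg _))
    have c2 := (real_inner_le_norm (p r) (TT Ω ι w (z t, 0) - TT Ω ι w (z r, 0)).1).trans (mul_le_mul_of_nonneg_left ((norm_fst_le _).trans b2) (norm_nonneg _))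
    have c3 := (le_abs_self _).trans ((norm_snd_le (TT Ω ι w (z t, 0) - TT Ω ι w (z r, 0))).trans b2)
    have h2 : ‖w‖ ^ 2 ≤ ‖w‖ * (C * (‖p t - p r‖ + ‖p r‖ * ‖z t - z r‖ + ‖z t - z r‖)) := by
      rw [h1]; nlinarith
    have hC := hN.C0
    rcases (norm_nonneg w).eq_or_lt with h | h
    · rw [← h]; positivity
    · rw [sq] at h2; exact le_of_mul_le_mul_left h2 h
  intro r hr
  rw [ContinuousWithinAt, tendsto_iff_norm_sub_tendsto_zero]
  apply squeeze_zero' (g := fun t => C * (‖p t - p r‖ + ‖p r‖ * ‖z t - z r‖ + ‖z t - z r‖)) (Eventually.of_forall fun _ => norm_nonneg _)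
  · filter_upwards [self_mem_nhdsWithin] with t ht using key t ht r hr
  · have h1 := tendsto_iff_norm_sub_tendsto_zero.1 (hz r hr)
    have h2 := tendsto_iff_norm_sub_tendsto_zero.1 (hp r hr)
    simpa using ((h2.add (h1.const_mul ‖p r‖)).add h1).const_mul C
end
end

section

section
variable {d : ℕ} {V : Type*} [NormedAddCommGroup V] [InnerProductSpace ℝ V]
variable {Ω : Set (Euc d)} {ι : V →ₗ[ℝ] (Euc d → Euc d)} {Φ : (ℝ → V) → ℝ → ℝ → Euc d → Euc d} {C : ℝ}

theorem TT_on (hΩ : IsOpen Ω) (u : V) {x : Euc d} (hx : x ∈ Ω) (b : ℝ) : TT Ω ι u (x, b) = (ι u x, divg (ι u) x) := by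
  have h : indicator Ω (ι u) =ᶠ[𝓝 x] ι u := by
    filter_upwards [hΩ.mem_nhds hx] with y hy
    exact indicator_of_mem hy _
  simp only [TT, QQ, divg, h.fderiv_eq, indicator_of_mem hx]

theorem H_diff {H : Euc d → ℝ} (hΩ : IsOpen Ω) (hH : ContDiffOn ℝ 1 (fun x => Real.exp (H x)) (closure Ω)) {x : Euc d} (hx : x ∈ Ω) :
    DifferentiableAt ℝ H x := by
  have h1 : DifferentiableAt ℝ (fun x => Real.exp (H x)) x :=
    ((hH.mono subset_closure).differentiableOn (by norm_num) x hx).differentiableAt (hΩ.mem_nhds hx)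
  have := h1.log (Real.exp_ne_zero _)
  simpa using this

theorem single (S : Setup Ω ι Φ C) {v : ℝ → V} (hv : Good v) {x : Euc d} (hx : x ∈ Ω) {H : Euc d → ℝ}
    (hH : ∀ y ∈ Ω, DifferentiableAt ℝ H y) {rep : Euc d → Euc d → V}
    (hrep : ∀ x ∈ Ω, ∀ p : Euc d, ∀ u : V, ⟪rep x p, u⟫ = ⟪ι u x, p⟫)
    {drep : Euc d → V} (hdrep : ∀ x ∈ Ω, ∀ u : V, ⟪drep x, u⟫ = divg (ι u) x) 
    {A : ℝ → V} (hA : A = fun t => rep (Φ v 0 t x)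
                  (ContinuousLinearMap.adjoint (fderiv ℝ (Φ v t 1) (Φ v 0 t x))
                      (gradient H (Φ v 0 1 x))
                    + gradient (fun z => Real.log ((fderiv ℝ (Φ v t 1) z).det))
                        (Φ v 0 t x)) + drep (Φ v 0 t x)) :
    ContinuousOn A (Icc 0 1) ∧ ∀ u, Good u → IntervalIntegrable (fun s => ⟪A s, u s⟫) volume 0 1 ∧ 
      HasDerivAt (fun ε : ℝ => Real.log ((fderiv ℝ (Φ (fun t => v t + ε • u t) 0 1) x).det) + H (Φ (fun t => v t + ε • u t) 0 1 x))
        (∫ s in (0:ℝ)..1, ⟪A s, u s⟫) 0 := by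
  obtain ⟨P, hPc, hPb, hPf, hPg, hPd⟩ := S.main hv hx
  have h01 : (0:ℝ) ∈ Icc (0:ℝ) 1 := ⟨le_rfl, zero_le_one⟩
  have h11 : (1:ℝ) ∈ Icc (0:ℝ) 1 := ⟨zero_le_one, le_rfl⟩
  obtain ⟨hyΩ, hy⟩ := S.prim hv h01 hx
  have hyc := hy.cont zero_le_one
  let φ : Euc d × ℝ →L[ℝ] ℝ := (innerSL ℝ (gradient H (Φ v 0 1 x))).comp (ContinuousLinearMap.fst ℝ _ _) + ContinuousLinearMap.snd ℝ _ _
  let β : ℝ → Euc d := fun t => ContinuousLinearMap.adjoint (fderiv ℝ (Φ v t 1) (Φ v 0 t x))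
                      (gradient H (Φ v 0 1 x))
                    + gradient (fun z => Real.log ((fderiv ℝ (Φ v t 1) z).det))
                        (Φ v 0 t x)
  have hφ : ∀ t ∈ Icc (0:ℝ) 1, ∀ h : Euc d, ⟪β t, h⟫ = φ (P t (h, 0)) := by
    intro t ht h
    simp only [β, inner_add_left, hPg t ht, ContinuousLinearMap.adjoint_inner_left, hPf t ht]
    simp [φ]
  have hβ : ContinuousOn β (Icc 0 1) := by
    have h1 : ContinuousOn (fun t => (InnerProductSpace.toDual ℝ (Euc d)).symm ((φ.comp (P t)).comp (ContinuousLinearMap.inl ℝ _ _))) (Icc 0 1) := by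
      apply (LinearIsometryEquiv.continuous _).comp_continuousOn
      exact (continuousOn_const.clm_comp hPc).clm_comp continuousOn_const
    apply h1.congr
    intro t ht
    apply ext_inner_right ℝ
    intro h
    rw [hφ t ht, InnerProductSpace.toDual_symm_apply]
    rfl
  have hAu : ∀ t ∈ Icc (0:ℝ) 1, ∀ u, ⟪A t, u⟫ = ⟪β t, (TT Ω ι u (Φ v 0 t x, 0)).1⟫ + (TT Ω ι u (Φ v 0 t x, 0)).2 := by
    intro t ht u
    rw [TT_on S.hΩ _ (hyΩ t ht)]
    simp only [hA]
    rw [inner_add_left, hrep _ (hyΩ t ht), hdrep _ (hyΩ t ht), real_inner_comm]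
  have hAc := repr_cont S.hN hyc hβ hAu
  have hAP : ∀ t ∈ Icc (0:ℝ) 1, ∀ u, ⟪A t, u⟫ = φ (P t (TT Ω ι u (Φ v 0 t x, 0))) := by
    intro t ht u
    rw [hAu t ht, hφ t ht]
    set q := TT Ω ι u (Φ v 0 t x, 0)
    have e : q = (q.1, 0) + (0, q.2) := by simp
    conv_rhs => rw [e, map_add, hPb t ht, map_add]
    simp [φ]
  refine ⟨hAc, fun u hu => ?_⟩
  obtain ⟨hi, hd⟩ := hPd u hu
  have hi2 : IntervalIntegrable (fun s => φ (P s (TT Ω ι (u s) (Φ v 0 s x, 0)))) volume 0 1 := 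
    ⟨φ.integrable_comp hi.1, φ.integrable_comp hi.2⟩
  have heq : EqOn (fun s => φ (P s (TT Ω ι (u s) (Φ v 0 s x, 0)))) (fun s => ⟪A s, u s⟫) (uIcc 0 1) := by
    intro t ht
    rw [uIcc_of_le zero_le_one] at ht
    exact (hAP t ht _).symm
  refine ⟨hi2.congr (heq.mono uIoc_subset_uIcc), ?_⟩
  rw [← intervalIntegral.integral_congr heq, φ.intervalIntegral_comp_comm hi]
  have hF : HasFDerivAt (fun q : Euc d × ℝ => q.2 + H q.1) φ (Φ v 0 1 x, Real.log ((fderiv ℝ (Φ v 0 1) x).det)) := by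
    have hH1 := (hH _ (hyΩ 1 h11)).hasGradientAt.hasFDerivAt
    have h2 := (hasFDerivAt_snd (𝕜 := ℝ) (p := (Φ v 0 1 x, Real.log ((fderiv ℝ (Φ v 0 1) x).det)))).add 
      (HasFDerivAt.comp (Φ v 0 1 x, Real.log ((fderiv ℝ (Φ v 0 1) x).det)) hH1 hasFDerivAt_fst)
    refine h2.congr_fderiv ?_
    ext <;> simp [φ]
  have e0 : (fun t => v t + (0:ℝ) • u t) = v := by simp
  exact HasFDerivAt.comp_hasDerivAt (0:ℝ) (by rw [e0]; exact hF) hd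

theorem pen (lam : ℝ) {v u : ℝ → V} (hv : Good v) (hu : Good u) :
    HasDerivAt (fun ε : ℝ => (lam / 2) * ∫ t in (0:ℝ)..1, ‖v t + ε • u t‖ ^ 2) (lam * ∫ t in (0:ℝ)..1, ⟪v t, u t⟫) 0 := by
  have h1 : ∀ ε : ℝ, (∫ t in (0:ℝ)..1, ‖v t + ε • u t‖ ^ 2) = (∫ t in (0:ℝ)..1, ‖v t‖ ^ 2) + (2 * ε) * (∫ t in (0:ℝ)..1, ⟪v t, u t⟫) 
      + ε ^ 2 * ∫ t in (0:ℝ)..1, ‖u t‖ ^ 2 := by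
    intro ε
    rw [← intervalIntegral.integral_const_mul, ← intervalIntegral.integral_const_mul,
      ← intervalIntegral.integral_add hv.sq ((hv.inner hu).const_mul _),
      ← intervalIntegral.integral_add (hv.sq.add ((hv.inner hu).const_mul _)) (hu.sq.const_mul _)]
    congr 1
    ext t
    rw [norm_add_sq_real, norm_smul, inner_smul_right, mul_pow]
    simp
    ring
  simp only [h1]
  set a := ∫ t in (0:ℝ)..1, ‖v t‖ ^ 2
  set b := ∫ t in (0:ℝ)..1, ⟪v t, u t⟫
  set c := ∫ t in (0:ℝ)..1, ‖u t‖ ^ 2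
  have hi := hasDerivAt_id (0:ℝ)
  have := ((((hi.const_mul 2).mul_const b).const_add a).add ((hi.pow 2).mul_const c)).const_mul (lam / 2)
  refine HasDerivAt.congr_deriv this ?_
  simp
  ring
end
end

/-- the Hilbert norm of the diagnostic field `λv_t − D_t^v` equals the
maximal directional derivative of the penalized log-likelihood over unit directions
`u ∈ V^{[0,1]}`:
`(∫₀¹‖λv_t − D_t^v‖²_V dt)^{1/2} = sup_{‖u‖=1} [d/dε E_λ(v+εu)]_{ε=0}`. -/
theorem stmt_19 {d : ℕ} (Ω : Set (Euc d)) (hΩo : IsOpen Ω) (hΩb : Bornology.IsBounded Ω)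
    (V : Type*) [NormedAddCommGroup V] [InnerProductSpace ℝ V] [CompleteSpace V]
    [MeasurableSpace V] [BorelSpace V]
    (ι : V →ₗ[ℝ] (Euc d → Euc d)) (hinj : Function.Injective ι)
    (c : ℝ) (hc : 0 < c)
    (hemb : ∀ f : V, MemC0k 3 Ω (ι f) ∧ CknormOn 3 Ω (ι f) ≤ c * ‖f‖)
    -- the reproducing kernel `R(x,y) I_{d×d}` and its representers
    (R : Euc d → Euc d → ℝ)
    (rep : Euc d → Euc d → V)
    (hrepval : ∀ x ∈ Ω, ∀ p : Euc d, ∀ z : Euc d, ι (rep x p) z = R x z • p)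
    (hrep : ∀ x ∈ Ω, ∀ p : Euc d, ∀ u : V, ⟪rep x p, u⟫ = ⟪ι u x, p⟫)
    (drep : Euc d → V)
    (hdrepval : ∀ x ∈ Ω, ∀ z : Euc d, ι (drep x) z = gradient (fun y => R z y) x)
    (hdrep : ∀ x ∈ Ω, ∀ u : V, ⟪drep x, u⟫ = divg (ι u) x)
    -- `e^H` is a `C¹(Ω̄)` probability density on `Ω`
    (H : Euc d → ℝ)
    (hH : ContDiffOn ℝ 1 (fun x => Real.exp (H x)) (closure Ω))
    (hHd : ∫ x in Ω, Real.exp (H x) = 1)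
    -- data and tuning parameter
    (n : ℕ) (hn : 0 < n) (X : Fin n → Euc d) (hX : ∀ k, X k ∈ Ω)
    (lam : ℝ) (hlam : 0 < lam)
    -- the flow `Φ v s t = φ^v_{st}`
    (Φ : (ℝ → V) → ℝ → ℝ → Euc d → Euc d)
    (hflow : ∀ v : ℝ → V, InV01 v → ∀ s ∈ Icc (0:ℝ) 1, ∀ t ∈ Icc (0:ℝ) 1, ∀ x ∈ Ω,
      Φ v s t x = x + ∫ u in s..t, ι (v u) (Φ v s u x))
    (v : ℝ → V) (hv : InV01 v) :
    Real.sqrt (∫ t in (0:ℝ)..1,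
        ‖lam • v t -
            (1 / (n : ℝ)) •
              ((∑ k, rep (Φ v 0 t (X k))
                  (ContinuousLinearMap.adjoint (fderiv ℝ (Φ v t 1) (Φ v 0 t (X k)))
                      (gradient H (Φ v 0 1 (X k)))
                    + gradient (fun z => Real.log ((fderiv ℝ (Φ v t 1) z).det))
                        (Φ v 0 t (X k))))
                + ∑ k, drep (Φ v 0 t (X k)))‖ ^ 2)
      = ⨆ u : {u : ℝ → V // InV01 u ∧ normV01 u = 1},
          deriv (fun ε : ℝ => Elam ι Φ H X lam (fun t => v t + ε • u.1 t)) 0 := by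
  have S : Setup Ω ι Φ ((1 + ‖trL d‖) * c) :=
    { hΩ := hΩo
      hN := TT_nice hΩo hΩb hc hemb
      hQ := fun f => (QQ_bounds (ext_bound hΩo hΩb (hemb f).1).1 (ext_bound hΩo hΩb (hemb f).1).2).1
      flow := fun w hw => hflow w ((good_iff w).2 hw) }
  have hv' := (good_iff v).1 hv
  let A : Fin n → ℝ → V := fun k t => rep (Φ v 0 t (X k))
                  (ContinuousLinearMap.adjoint (fderiv ℝ (Φ v t 1) (Φ v 0 t (X k)))
                      (gradient H (Φ v 0 1 (X k)))
                    + gradient (fun z => Real.log ((fderiv ℝ (Φ v t 1) z).det))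
                        (Φ v 0 t (X k))) + drep (Φ v 0 t (X k))
  have hs := fun k => single S hv' (hX k) (fun y hy => H_diff hΩo hH hy) hrep hdrep (A := A k) rfl
  let D : ℝ → V := fun t => (1 / (n : ℝ)) • ∑ k, A k t
  have hDc : ContinuousOn D (Icc 0 1) := 
    ContinuousOn.const_smul (continuousOn_finset_sum _ fun k _ => (hs k).1) _
  let D' : ℝ → V := IccExtend (zero_le_one (α := ℝ)) ((Icc 0 1).restrict D)
  have hD' : Continuous D' := (continuousOn_iff_continuous_restrict.1 hDc).Icc_extend'
  have hDD : ∀ t ∈ Icc (0:ℝ) 1, D' t = D t := fun t ht => by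
    simp only [D']; rw [IccExtend_of_mem _ _ ht]; rfl
  have hg : Good (fun t => lam • v t + (-1:ℝ) • D' t) := (hv'.smul lam).add_smul (good_of_cont hD') (-1)
  have e : (fun t => lam • v t -
            (1 / (n : ℝ)) •
              ((∑ k, rep (Φ v 0 t (X k))
                  (ContinuousLinearMap.adjoint (fderiv ℝ (Φ v t 1) (Φ v 0 t (X k)))
                      (gradient H (Φ v 0 1 (X k)))
                    + gradient (fun z => Real.log ((fderiv ℝ (Φ v t 1) z).det))
                        (Φ v 0 t (X k))))
                + ∑ k, drep (Φ v 0 t (X k)))) = fun t => lam • v t - D t := by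
    funext t
    simp only [D, A, Finset.sum_add_distrib]
  have e' := fun t => congrFun e t
  simp only [e']
  refine sup_lemma (g := fun t => lam • v t - D t) hg (fun t ht => ?_)
    (fun u => deriv (fun ε : ℝ => Elam ι Φ H X lam (fun t => v t + ε • u t)) 0) (fun u hu => ?_)
  · rw [hDD t ht]; simp [sub_eq_add_neg]
  · have h1 : HasDerivAt (fun ε : ℝ => Elam ι Φ H X lam (fun t => v t + ε • u t))
        ((1 / (n : ℝ)) * (∑ k, ∫ s in (0:ℝ)..1, ⟪A k s, u s⟫) - lam * ∫ t in (0:ℝ)..1, ⟪v t, u t⟫) 0 := by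
      unfold Elam
      exact ((HasDerivAt.fun_sum fun k _ => ((hs k).2 u hu).2).const_mul _).sub (pen lam hv' hu)
    rw [h1.deriv]
    have hsum : IntervalIntegrable (fun s => ∑ k, ⟪A k s, u s⟫) volume 0 1 := by
      have := IntervalIntegrable.sum (μ := volume) (a := 0) (b := 1) Finset.univ (f := fun k s => ⟪A k s, u s⟫) (fun k _ => ((hs k).2 u hu).1)
      simpa [Finset.sum_fn] using this
    rw [← intervalIntegral.integral_finset_sum (fun k _ => ((hs k).2 u hu).1), ← intervalIntegral.integral_const_mul,
      ← intervalIntegral.integral_const_mul, ← intervalIntegral.integral_sub (hsum.const_mul _) ((hv'.inner hu).const_mul _),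
      ← intervalIntegral.integral_neg]
    congr 1
    funext t
    simp only [D, inner_sub_left, inner_smul_left, sum_inner]
    simp
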